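/- arXiv:2303.12435 — 3 statements merged into one kernel-verified Lean document; each statement's English description precedes it below -/
import Mathlib

section
/- Let S(t) be a strongly continuous one-parameter semigroup on a complex Hilbert space H with generator A. Let ω ∈ ℝ and r > 0 be such that the resolvent bound R(ω, r) holds. Let m : [0,∞) → (0,∞) be a continuous positive function with ‖S(t)‖ ≤ m(t) for all t ≥ 0. Then for all a, b > 0 and all t ≥ a + b, ‖S(t)‖ ≤ e^{ωt − r(t−a−b)} / ( r · N_a(m,ω) · N_b(m,ω) ), where N_c(m,ω) := (∫₀^c e^{2ωs} m(s)^{−2} ds)^{1/2}. -/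
open Set MeasureTheory

/-- A strongly continuous one-parameter semigroup on a Hilbert space. -/
structure IsC0Semigroup {H : Type*} [NormedAddCommGroup H] [InnerProductSpace ℂ H]
    (S : ℝ → H →L[ℂ] H) : Prop where
  map_zero : S 0 = 1
  map_add : ∀ s, 0 ≤ s → ∀ t, 0 ≤ t → S (s + t) = S s ∘L S t
  cont : ∀ x : H, ContinuousOn (fun t => S t x) (Ici 0)

/-- `A : D →ₗ[ℂ] H` (with `D` a dense subspace of `H`) is the generator of the semigroup `S`. -/
structure IsGenerator {H : Type*} [NormedAddCommGroup H] [InnerProductSpace ℂ H]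
    (S : ℝ → H →L[ℂ] H) (D : Submodule ℂ H) (A : D →ₗ[ℂ] H) : Prop where
  dense : Dense (D : Set H)
  mem : ∀ (x : D) (t : ℝ), 0 ≤ t → S t (x : H) ∈ D
  hasDeriv : ∀ (x : D) (t : ℝ) (ht : 0 ≤ t),
    HasDerivWithinAt (fun s => S s (x : H)) (A ⟨S t (x : H), mem x t ht⟩) (Ici 0) t
  commutes : ∀ (x : D) (t : ℝ) (ht : 0 ≤ t),
    A ⟨S t (x : H), mem x t ht⟩ = S t (A x)

/-- The resolvent bound `R(ω, r)`: for every `z` with `Re z > ω`, `z - A : D(A) → H` is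
bijective and `‖(z - A) x‖ ≥ r ‖x‖`, i.e. `‖(z - A)⁻¹‖ ≤ 1/r`. -/
def ResolventBound {H : Type*} [NormedAddCommGroup H] [InnerProductSpace ℂ H]
    (D : Submodule ℂ H) (A : D →ₗ[ℂ] H) (ω r : ℝ) : Prop :=
  ∀ z : ℂ, ω < z.re →
    Function.Bijective (fun x : D => z • (x : H) - A x) ∧
    ∀ x : D, r * ‖(x : H)‖ ≤ ‖z • (x : H) - A x‖

open FourierTransform SchwartzMap ContDiff in
/-- Plancherel's theorem for integrable, square-integrable vector-valued functions. -/
theorem eLpNorm_two_fourier_eq {F : Type*} [NormedAddCommGroup F] [InnerProductSpace ℂ F]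
    [CompleteSpace F] {f : ℝ → F} (hf : Integrable f) (hf2 : MemLp f 2) :
    eLpNorm (𝓕 f) 2 = eLpNorm f 2 := by
  have hc : Continuous (𝓕 f) :=
    VectorFourier.fourierIntegral_continuous (L := innerₗ ℝ) Real.continuous_fourierChar
      continuous_inner hf
  have key : ⇑(Lp.fourierTransformₗᵢ ℝ F (hf2.toLp f)) =ᵐ[volume] (𝓕 f : ℝ → F) := by
    refine ae_eq_of_integral_contDiff_smul_eq
      ((Lp.memLp _).locallyIntegrable (by norm_num)) ?_ ?_
    · exact hc.locallyIntegrable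
    intro g hg hgc
    have h1 : HasCompactSupport (fun x => (g x : ℂ)) :=
      hgc.comp_left (g := Complex.ofReal) Complex.ofReal_zero
    have h2 : ContDiff ℝ ∞ (fun x => (g x : ℂ)) := Complex.ofRealCLM.contDiff.comp hg
    set G : 𝓢(ℝ, ℂ) := h1.toSchwartzMap h2 with hG
    have hGx : ∀ x, G x = (g x : ℂ) := fun x => rfl
    have := congrArg (fun T => T G) (Lp.fourier_toTemperedDistribution_eq (hf2.toLp f))
    simp only [TemperedDistribution.fourier_apply, Lp.toTemperedDistribution_apply] at this
    have e1 : ∫ x, (𝓕 G) x • (hf2.toLp f) x = ∫ x, (𝓕 G) x • f x := by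
      apply integral_congr_ae
      filter_upwards [hf2.coeFn_toLp] with x hx
      rw [hx]
    have e2 : ∫ x, (𝓕 (G : ℝ → ℂ)) x • f x = ∫ x, G x • (𝓕 f) x := by
      simpa using! (VectorFourier.integral_fourierIntegral_smul_eq_flip (L := innerₗ ℝ)
        Real.continuous_fourierChar continuous_inner G.integrable hf)
    rw [e1, SchwartzMap.fourier_coe, e2] at this
    have h3 : ∫ x, G x • (Lp.fourierTransformₗᵢ ℝ F (hf2.toLp f)) x = ∫ x, G x • (𝓕 f) x :=
      this.symm
    simpa [hGx] using h3
  rw [← eLpNorm_congr_ae key, ← eLpNorm_congr_ae hf2.coeFn_toLp, ← Lp.enorm_def, ← Lp.enorm_def,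
    ← ofReal_norm, ← ofReal_norm, LinearIsometryEquiv.norm_map]

theorem eLpNorm_two_eq_ofReal_sqrt {α F : Type*} [MeasurableSpace α] {μ : Measure α}
    [NormedAddCommGroup F] {f : α → F} (hf : MemLp f 2 μ) :
    eLpNorm f 2 μ = ENNReal.ofReal (√(∫ t, ‖f t‖ ^ 2 ∂μ)) := by
  rw [hf.eLpNorm_eq_integral_rpow_norm (by norm_num) (by norm_num), Real.sqrt_eq_rpow]
  norm_num

/-- If the Fourier transforms satisfy a pointwise norm inequality, then so do the `L²` norms. -/
theorem integral_norm_sq_le_of_fourier_le {F : Type*} [NormedAddCommGroup F]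
    [InnerProductSpace ℂ F] [CompleteSpace F] {u f : ℝ → F} {r : ℝ} (hr : 0 < r)
    (hu : Integrable u) (hu2 : MemLp u 2) (hf : Integrable f) (hf2 : MemLp f 2)
    (h : ∀ ξ, r * ‖FourierTransform.fourier u ξ‖ ≤ ‖FourierTransform.fourier f ξ‖) :
    r ^ 2 * ∫ t, ‖u t‖ ^ 2 ≤ ∫ t, ‖f t‖ ^ 2 := by
  have h1 : eLpNorm u 2 ≤ ENNReal.ofReal (1 / r) * eLpNorm f 2 := by
    rw [← eLpNorm_two_fourier_eq hu hu2, ← eLpNorm_two_fourier_eq hf hf2]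
    refine eLpNorm_le_mul_eLpNorm_of_ae_le_mul (Filter.Eventually.of_forall fun ξ => ?_) 2
    rw [one_div_mul_eq_div, le_div_iff₀' hr]
    exact h ξ
  rw [eLpNorm_two_eq_ofReal_sqrt hu2, eLpNorm_two_eq_ofReal_sqrt hf2,
    ← ENNReal.ofReal_mul (by positivity), ENNReal.ofReal_le_ofReal_iff (by positivity),
    one_div_mul_eq_div, le_div_iff₀' hr] at h1
  have h2 := pow_le_pow_left₀ (by positivity) h1 2
  rwa [mul_pow, Real.sq_sqrt (by positivity), Real.sq_sqrt (by positivity)] at h2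

section Semigroup

variable {H : Type*} [NormedAddCommGroup H] [InnerProductSpace ℂ H]
  {S : ℝ → H →L[ℂ] H} {D : Submodule ℂ H} {A : D →ₗ[ℂ] H} {ω r : ℝ}

theorem ResolventBound.mono (h : ResolventBound D A ω r) {σ : ℝ} (hσ : ω ≤ σ) :
    ResolventBound D A σ r :=
  fun z hz => h z (hσ.trans_lt hz)

theorem ResolventBound.exists_inverse (h : ResolventBound D A ω r) (hr : 0 < r) {z : ℂ}
    (hz : ω < z.re) :
    ∃ R : H →L[ℂ] H, (∀ y, r * ‖R y‖ ≤ ‖y‖) ∧ ∀ x : D, R (z • (x : H) - A x) = x := by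
  obtain ⟨hbij, hb⟩ := h z hz
  let E : D ≃ₗ[ℂ] H := LinearEquiv.ofBijective (z • D.subtype - A) hbij
  have hE : ∀ x : D, E x = z • (x : H) - A x := fun x => rfl
  have hR : ∀ y, r * ‖(E.symm y : H)‖ ≤ ‖y‖ := fun y => by
    simpa [← hE] using hb (E.symm y)
  refine ⟨(D.subtype ∘ₗ E.symm.toLinearMap).mkContinuous (1 / r) fun y => ?_, fun y => ?_,
    fun x => ?_⟩
  · rw [one_div_mul_eq_div, le_div_iff₀' hr]
    exact hR y
  · exact hR y
  · simp [← hE]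

/-- A weighted orbit, cut off to a bounded interval, lies in every `Lᵖ`. -/
theorem IsC0Semigroup.memLp_indicator_orbit (hS : IsC0Semigroup S) (x : H) {L C : ℝ}
    {k : ℝ → ℝ} (hk : AEStronglyMeasurable k (volume.restrict (Ioc 0 L)))
    (hC : ∀ t ∈ Ioc 0 L, |k t| ≤ C) (p : ENNReal) :
    MemLp (indicator (Ioc 0 L) fun t => k t • S t x) p := by
  rw [memLp_indicator_iff_restrict measurableSet_Ioc]
  have hv : ContinuousOn (fun t => S t x) (Icc 0 L) := (hS.cont x).mono Icc_subset_Ici_self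
  obtain ⟨B, hB⟩ := isCompact_Icc.exists_bound_of_continuousOn hv
  refine MemLp.of_bound (C := C * B) (hk.smul
    ((hv.mono Ioc_subset_Icc_self).aestronglyMeasurable measurableSet_Ioc)) ?_
  filter_upwards [ae_restrict_mem measurableSet_Ioc] with t ht
  rw [norm_smul]
  exact mul_le_mul (hC t ht) (hB t (Ioc_subset_Icc_self ht)) (norm_nonneg _)
    ((abs_nonneg _).trans (hC t ht))

theorem IsC0Semigroup.fourier_indicator_orbit (x : H) {L : ℝ} (hL : 0 ≤ L)
    (k : ℝ → ℝ) (σ ξ : ℝ) :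
    FourierTransform.fourier
      (indicator (Ioc 0 L) fun t => (k t * Real.exp (-σ * t)) • S t x) ξ =
      ∫ t in 0..L, ((k t : ℂ) * Complex.exp (-(σ + 2 * Real.pi * ξ * Complex.I) * t)) • S t x := by
  rw [Real.fourier_real_eq_integral_exp_smul, intervalIntegral.integral_of_le hL,
    ← integral_indicator measurableSet_Ioc]
  congr 1
  ext t
  by_cases ht : t ∈ Ioc 0 L
  · simp only [indicator_of_mem ht]
    rw [← Complex.coe_smul, smul_smul]
    congr 1
    push_cast
    rw [mul_left_comm, ← Complex.exp_add]
    congr 2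
    ring
  · simp [indicator_of_notMem ht]

theorem IsC0Semigroup.continuousOn_weight (hS : IsC0Semigroup S) (x : H) (σ : ℝ) :
    ContinuousOn (fun t => Real.exp (-2 * σ * t) * ‖S t x‖ ^ 2) (Ici 0) :=
  (Continuous.continuousOn (by fun_prop)).mul ((hS.cont x).norm.pow 2)

theorem IsC0Semigroup.intervalIntegrable_weight (hS : IsC0Semigroup S) (x : H) (σ : ℝ)
    {c d : ℝ} (hc : 0 ≤ c) (hd : 0 ≤ d) :
    IntervalIntegrable (fun t => Real.exp (-2 * σ * t) * ‖S t x‖ ^ 2) volume c d :=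
  ((hS.continuousOn_weight x σ).mono fun _ ht => (le_inf hc hd).trans ht.1).intervalIntegrable

theorem IsC0Semigroup.intervalIntegrable_sq_mul_weight (hS : IsC0Semigroup S) (x : H) (σ : ℝ)
    {L C : ℝ} (hL : 0 ≤ L) {k : ℝ → ℝ} (hk : AEStronglyMeasurable k (volume.restrict (Ioc 0 L)))
    (hC : ∀ t ∈ Icc 0 L, |k t| ≤ C) :
    IntervalIntegrable (fun t => k t ^ 2 * (Real.exp (-2 * σ * t) * ‖S t x‖ ^ 2))
      volume 0 L := by
  refine IntervalIntegrable.mul_continuousOn ?_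
    ((hS.continuousOn_weight x σ).mono fun _ ht => (le_inf le_rfl hL).trans ht.1)
  rw [intervalIntegrable_iff_integrableOn_Ioc_of_le hL]
  refine IntegrableOn.of_bound (by simp) (hk.pow 2) (C ^ 2) ?_
  filter_upwards [ae_restrict_mem measurableSet_Ioc] with t ht
  rw [Real.norm_eq_abs, abs_pow]
  exact pow_le_pow_left₀ (abs_nonneg _) (hC t (Ioc_subset_Icc_self ht)) 2

/-- A semigroup bounded on `[0, 1]` is exponentially bounded. -/
theorem IsC0Semigroup.exists_growth_bound (hS : IsC0Semigroup S) {M : ℝ}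
    (hM : ∀ t ∈ Icc (0 : ℝ) 1, ‖S t‖ ≤ M) :
    ∃ σ C : ℝ, ∀ t, 0 ≤ t → ‖S t‖ ≤ C * Real.exp (σ * t) := by
  set B := max M 1 with hB
  have hB1 : 1 ≤ B := le_max_right _ _
  have hB0 : 0 < B := by linarith
  have hn : ∀ n : ℕ, ∀ t : ℝ, 0 ≤ t → t ≤ n + 1 → ‖S t‖ ≤ B ^ (n + 1) := by
    intro n
    induction n with
    | zero =>
      intro t h0 h1
      rw [zero_add, pow_one]
      exact (hM t ⟨h0, by simpa using h1⟩).trans (le_max_left M 1)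
    | succ n ih =>
      intro t h0 h1
      rcases le_total t 1 with h | h
      · exact ((hM t ⟨h0, h⟩).trans (le_max_left M 1)).trans (le_self_pow₀ hB1 (by omega))
      · have h2 := hS.map_add 1 zero_le_one (t - 1) (by linarith)
        rw [add_sub_cancel] at h2
        rw [h2, pow_succ']
        refine (ContinuousLinearMap.opNorm_comp_le _ _).trans (mul_le_mul
          ((hM 1 (by simp)).trans (le_max_left M 1))
          (ih (t - 1) (by linarith) (by push_cast at h1; linarith)) (norm_nonneg _) hB0.le)
  refine ⟨Real.log B, B, fun t ht => ?_⟩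
  refine (hn ⌊t⌋₊ t ht (Nat.lt_floor_add_one t).le).trans ?_
  rw [pow_succ', Real.exp_mul, Real.exp_log hB0, ← Real.rpow_natCast]
  gcongr
  exact Nat.floor_le ht

variable [CompleteSpace H]

/-- The resolvent maps the Laplace transform of `χ' S x` to that of `χ S x`. -/
theorem IsGenerator.resolvent_integral_orbit (hS : IsC0Semigroup S) (hA : IsGenerator S D A)
    {z : ℂ} {R : H →L[ℂ] H} (hR : ∀ x : D, R (z • (x : H) - A x) = x) (x : D) {L : ℝ} (hL : 0 ≤ L)
    {χ ψ : ℝ → ℝ} {s : Set ℝ} (hs : s.Countable) (hχ : ContinuousOn χ (Icc 0 L))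
    (hχ0 : χ 0 = 0) (hχL : χ L = 0) (hψ : IntervalIntegrable ψ volume 0 L)
    (hd : ∀ t ∈ Ioo 0 L \ s, HasDerivAt χ (ψ t) t) :
    R (∫ t in 0..L, ((ψ t : ℂ) * Complex.exp (-z * t)) • S t (x : H)) =
      ∫ t in 0..L, ((χ t : ℂ) * Complex.exp (-z * t)) • S t (x : H) := by
  have hv : ContinuousOn (fun t => S t (x : H)) (Icc 0 L) :=
    (hS.cont x).mono Icc_subset_Ici_self
  have hu : uIcc 0 L = Icc 0 L := uIcc_of_le hL
  have hχc : ContinuousOn (fun t => (χ t : ℂ)) (Icc 0 L) :=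
    Complex.continuous_ofReal.comp_continuousOn hχ
  have he : Continuous fun t : ℝ => Complex.exp (-z * t) := by fun_prop
  have hi1 : IntervalIntegrable (fun t => ((ψ t : ℂ) * Complex.exp (-z * t)) • S t (x : H))
      volume 0 L := by
    have h1 : IntervalIntegrable (fun t => (ψ t : ℂ)) volume 0 L :=
      ⟨hψ.1.ofReal, hψ.2.ofReal⟩
    exact (h1.mul_continuousOn he.continuousOn).smul_continuousOn (hu ▸ hv)
  have hc2 : ContinuousOn (fun t => ((χ t : ℂ) * Complex.exp (-z * t)) • S t (x : H))
      (Icc 0 L) := (hχc.mul he.continuousOn).smul hv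
  have hi2 := (hu ▸ hc2 : ContinuousOn _ (uIcc 0 L)).intervalIntegrable (μ := volume)
  have hi3 : IntervalIntegrable
      (fun t => R (((ψ t : ℂ) * Complex.exp (-z * t)) • S t (x : H))) volume 0 L :=
    ⟨R.integrable_comp hi1.1, R.integrable_comp hi1.2⟩
  have key := integral_eq_of_hasDerivAt_off_countable_of_le
    (fun t => R (((χ t : ℂ) * Complex.exp (-z * t)) • S t (x : H)))
    (fun t => R (((ψ t : ℂ) * Complex.exp (-z * t)) • S t (x : H)) -
      ((χ t : ℂ) * Complex.exp (-z * t)) • S t (x : H)) hL hs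
    (R.continuous.comp_continuousOn hc2) ?_ (hi3.sub hi2)
  · rw [intervalIntegral.integral_sub hi3 hi2,
      ContinuousLinearMap.intervalIntegral_comp_comm _ hi1] at key
    simpa [hχ0, hχL, sub_eq_zero] using key
  intro t ht
  have ht0 : 0 ≤ t := ht.1.1.le
  have hdS := (hA.hasDeriv x t ht0).hasDerivAt (Ici_mem_nhds ht.1.1)
  have hde : HasDerivAt (fun t : ℝ => Complex.exp (-z * t)) (Complex.exp (-z * t) * (-z)) t := by
    simpa using ((hasDerivAt_id t).ofReal_comp.const_mul (-z)).cexp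
  have hR' : R (A ⟨S t x, hA.mem x t ht0⟩) = z • R (S t x) - S t x := by
    have h := hR ⟨S t x, hA.mem x t ht0⟩
    rw [map_sub, map_smul] at h
    exact (sub_eq_iff_eq_add.1 h ▸ (add_sub_cancel_left _ _).symm)
  have hdu := (((hd t ht).ofReal_comp.mul hde).smul hdS)
  refine ((R.restrictScalars ℝ).hasFDerivAt.comp_hasDerivAt t hdu).congr_deriv ?_
  simp only [ContinuousLinearMap.coe_restrictScalars', Pi.mul_apply, map_add, map_smul, hR']
  module

/-- The energy inequality on a vertical line strictly to the right of `ω`. -/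
theorem IsGenerator.energy_le_of_lt (hS : IsC0Semigroup S) (hA : IsGenerator S D A)
    (hr : 0 < r) (hres : ResolventBound D A ω r) (x : D) {σ : ℝ} (hσ : ω < σ)
    {L C : ℝ} (hL : 0 ≤ L) {χ ψ : ℝ → ℝ} {s : Set ℝ} (hs : s.Countable)
    (hχ : ContinuousOn χ (Icc 0 L)) (hχ0 : χ 0 = 0) (hχL : χ L = 0)
    (hψ : Measurable ψ) (hC : ∀ t ∈ Icc 0 L, |ψ t| ≤ C)
    (hd : ∀ t ∈ Ioo 0 L \ s, HasDerivAt χ (ψ t) t) :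
    r ^ 2 * ∫ t in 0..L, χ t ^ 2 * (Real.exp (-2 * σ * t) * ‖S t (x : H)‖ ^ 2) ≤
      ∫ t in 0..L, ψ t ^ 2 * (Real.exp (-2 * σ * t) * ‖S t (x : H)‖ ^ 2) := by
  have hmem : ∀ k : ℝ → ℝ, AEStronglyMeasurable k (volume.restrict (Ioc 0 L)) →
      ∀ B : ℝ, (∀ t ∈ Icc 0 L, |k t| ≤ B) → ∀ p : ENNReal,
      MemLp (indicator (Ioc 0 L) fun t => (k t * Real.exp (-σ * t)) • S t (x : H)) p := by
    intro k hk B hB p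
    have he : Continuous fun t : ℝ => Real.exp (-σ * t) := by fun_prop
    obtain ⟨E, hE⟩ := (isCompact_Icc (a := 0) (b := L)).exists_bound_of_continuousOn
      he.continuousOn
    refine hS.memLp_indicator_orbit x (C := B * E) (hk.mul he.aestronglyMeasurable)
      (fun t ht => ?_) p
    have ht' := Ioc_subset_Icc_self ht
    rw [Pi.mul_apply, abs_mul]
    exact mul_le_mul (hB t ht') (hE t ht') (abs_nonneg _) ((abs_nonneg _).trans (hB t ht'))
  obtain ⟨B, hB⟩ := isCompact_Icc.exists_bound_of_continuousOn hχ
  have hu := hmem χ ((hχ.mono Ioc_subset_Icc_self).aestronglyMeasurable measurableSet_Ioc) B hB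
  have hf := hmem ψ hψ.aestronglyMeasurable C hC
  have hψi : IntervalIntegrable ψ volume 0 L := by
    rw [intervalIntegrable_iff_integrableOn_Ioc_of_le hL]
    refine Measure.integrableOn_of_bounded (M := C) (by simp) hψ.aestronglyMeasurable ?_
    filter_upwards [ae_restrict_mem measurableSet_Ioc] with t ht
    exact hC t (Ioc_subset_Icc_self ht)
  have hsq : ∀ k : ℝ → ℝ,
      ∫ t, ‖indicator (Ioc 0 L) (fun t => (k t * Real.exp (-σ * t)) • S t (x : H)) t‖ ^ 2 =
      ∫ t in 0..L, k t ^ 2 * (Real.exp (-2 * σ * t) * ‖S t (x : H)‖ ^ 2) := by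
    intro k
    rw [intervalIntegral.integral_of_le hL, ← integral_indicator measurableSet_Ioc]
    congr 1
    ext t
    by_cases ht : t ∈ Ioc 0 L
    · simp only [indicator_of_mem ht]
      rw [norm_smul, mul_pow, Real.norm_eq_abs, sq_abs, mul_pow, ← Real.exp_nat_mul, mul_assoc]
      congr 3
      push_cast
      ring
    · simp [indicator_of_notMem ht]
  have key := integral_norm_sq_le_of_fourier_le hr (memLp_one_iff_integrable.1 (hu 1)) (hu 2)
    (memLp_one_iff_integrable.1 (hf 1)) (hf 2) fun ξ => by
      obtain ⟨R, hRb, hR⟩ := hres.exists_inverse hr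
        (z := σ + 2 * Real.pi * ξ * Complex.I) (by simpa using hσ)
      rw [IsC0Semigroup.fourier_indicator_orbit _ hL, IsC0Semigroup.fourier_indicator_orbit _ hL,
        ← hA.resolvent_integral_orbit hS hR x hL hs hχ hχ0 hχL hψi hd]
      exact hRb _
  rwa [hsq, hsq] at key

/-- The energy inequality on the critical line. -/
theorem IsGenerator.energy_le (hS : IsC0Semigroup S) (hA : IsGenerator S D A)
    (hr : 0 < r) (hres : ResolventBound D A ω r) (x : D)
    {L C : ℝ} (hL : 0 ≤ L) {χ ψ : ℝ → ℝ} {s : Set ℝ} (hs : s.Countable)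
    (hχ : ContinuousOn χ (Icc 0 L)) (hχ0 : χ 0 = 0) (hχL : χ L = 0)
    (hψ : Measurable ψ) (hC : ∀ t ∈ Icc 0 L, |ψ t| ≤ C)
    (hd : ∀ t ∈ Ioo 0 L \ s, HasDerivAt χ (ψ t) t) :
    r ^ 2 * ∫ t in 0..L, χ t ^ 2 * (Real.exp (-2 * ω * t) * ‖S t (x : H)‖ ^ 2) ≤
      ∫ t in 0..L, ψ t ^ 2 * (Real.exp (-2 * ω * t) * ‖S t (x : H)‖ ^ 2) := by
  obtain ⟨B, hB⟩ := isCompact_Icc.exists_bound_of_continuousOn hχ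
  have hχi := fun σ => hS.intervalIntegrable_sq_mul_weight (x : H) σ hL
    ((hχ.mono Ioc_subset_Icc_self).aestronglyMeasurable measurableSet_Ioc) hB
  have hψi := fun σ => hS.intervalIntegrable_sq_mul_weight (x : H) σ hL
    hψ.aestronglyMeasurable hC
  set I := ∫ t in 0..L, χ t ^ 2 * (Real.exp (-2 * ω * t) * ‖S t (x : H)‖ ^ 2) with hI
  have hlim : Filter.Tendsto (fun σ => r ^ 2 * (Real.exp (-2 * (σ - ω) * L) * I))
      (nhdsWithin ω (Ioi ω)) (nhds (r ^ 2 * I)) := by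
    have hc : Continuous fun σ => r ^ 2 * (Real.exp (-2 * (σ - ω) * L) * I) := by fun_prop
    simpa using (hc.tendsto ω).mono_left nhdsWithin_le_nhds
  refine le_of_tendsto hlim ?_
  filter_upwards [self_mem_nhdsWithin] with σ (hσ : ω < σ)
  calc r ^ 2 * (Real.exp (-2 * (σ - ω) * L) * I)
      ≤ r ^ 2 * ∫ t in 0..L, χ t ^ 2 * (Real.exp (-2 * σ * t) * ‖S t (x : H)‖ ^ 2) := by
        rw [hI, ← intervalIntegral.integral_const_mul]
        refine mul_le_mul_of_nonneg_left (intervalIntegral.integral_mono_on hL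
          ((hχi ω).const_mul _) (hχi σ) fun t ht => ?_) (by positivity)
        rw [mul_left_comm, ← mul_assoc (Real.exp _), ← Real.exp_add]
        gcongr
        nlinarith [ht.1, ht.2]
    _ ≤ ∫ t in 0..L, ψ t ^ 2 * (Real.exp (-2 * σ * t) * ‖S t (x : H)‖ ^ 2) :=
        hA.energy_le_of_lt hS hr hres x hσ hL hs hχ hχ0 hχL hψ hC hd
    _ ≤ _ := by
        refine intervalIntegral.integral_mono_on hL (hψi σ) (hψi ω) fun t ht => ?_
        gcongr ?_ * (Real.exp ?_ * ?_)
        nlinarith [ht.1]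

/-- The function equal to `f` on `(-∞, c]` and to `g` on `(c, ∞)`. -/
noncomputable def glue (c : ℝ) (f g : ℝ → ℝ) (t : ℝ) : ℝ := if t ≤ c then f t else g t

theorem glue_of_le {c t : ℝ} (f g : ℝ → ℝ) (h : t ≤ c) : glue c f g t = f t := if_pos h

theorem glue_of_lt {c t : ℝ} (f g : ℝ → ℝ) (h : c < t) : glue c f g t = g t := if_neg h.not_ge

theorem Continuous.glue {c : ℝ} {f g : ℝ → ℝ} (hf : Continuous f) (hg : Continuous g)
    (h : f c = g c) : Continuous (glue c f g) :=
  hf.if_le hg continuous_id continuous_const fun t ht => by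
    obtain rfl : t = c := ht
    exact h

theorem Measurable.glue {c : ℝ} {f g : ℝ → ℝ} (hf : Measurable f) (hg : Measurable g) :
    Measurable (glue c f g) :=
  hf.ite measurableSet_Iic hg

theorem HasDerivAt.glue {c t : ℝ} {f g f' g' : ℝ → ℝ} (hf : HasDerivAt f (f' t) t)
    (hg : HasDerivAt g (g' t) t) (ht : t ≠ c) : HasDerivAt (glue c f g) (glue c f' g' t) t := by
  rcases ht.lt_or_gt with h | h
  · rw [glue_of_le _ _ h.le]
    refine hf.congr_of_eventuallyEq ?_
    filter_upwards [Iio_mem_nhds h] with s hs using glue_of_le _ _ (le_of_lt hs)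
  · rw [glue_of_lt _ _ h]
    refine hg.congr_of_eventuallyEq ?_
    filter_upwards [Ioi_mem_nhds h] with s hs using glue_of_lt _ _ hs

theorem exists_abs_glue_le {c : ℝ} {f g : ℝ → ℝ} {K : Set ℝ} (hf : ∃ C, ∀ t ∈ K, |f t| ≤ C)
    (hg : ∃ C, ∀ t ∈ K, |g t| ≤ C) : ∃ C, ∀ t ∈ K, |glue c f g t| ≤ C := by
  obtain ⟨B, hB⟩ := hf
  obtain ⟨C, hC⟩ := hg
  refine ⟨max B C, fun t ht => ?_⟩
  rcases le_or_gt t c with h | h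
  · rw [glue_of_le _ _ h]
    exact (hB t ht).trans (le_max_left _ _)
  · rw [glue_of_lt _ _ h]
    exact (hC t ht).trans (le_max_right _ _)

/-- Weighted `L²` bound for an orbit on `[T, L]`, up to an error coming from the cutoff at `L`. -/
theorem IsGenerator.integral_weight_le (hS : IsC0Semigroup S) (hA : IsGenerator S D A)
    (hr : 0 < r) (hres : ResolventBound D A ω r) (x : D) {φ : ℝ → ℝ} (hφc : Continuous φ)
    (hφ0 : ∀ t, 0 < φ t)
    (hφ : ∀ t, 0 ≤ t → φ t * (Real.exp (-2 * ω * t) * ‖S t (x : H)‖ ^ 2) ≤ ‖(x : H)‖ ^ 2)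
    {a T L B : ℝ} (ha : 0 < a) (haT : a ≤ T) (hTL : T ≤ L)
    (hB : ∀ t ∈ Icc L (L + 1), Real.exp (-2 * ω * t) * ‖S t (x : H)‖ ^ 2 ≤ B) :
    r ^ 2 * (Real.exp (r * (T - a)) ^ 2 *
      ∫ t in T..L, Real.exp (-2 * ω * t) * ‖S t (x : H)‖ ^ 2) ≤
      ‖(x : H)‖ ^ 2 / (∫ t in 0..a, φ t) + Real.exp (r * (T - a)) ^ 2 * B := by
  have hT : 0 ≤ T := ha.le.trans haT
  have hL : 0 ≤ L := hT.trans hTL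
  have hL1 : 0 ≤ L + 1 := by linarith
  set g : ℝ → ℝ := fun t => Real.exp (-2 * ω * t) * ‖S t (x : H)‖ ^ 2 with hg
  have hg0 : ∀ t, 0 ≤ g t := fun t => by positivity
  have hgi : ∀ c d, 0 ≤ c → 0 ≤ d → IntervalIntegrable g volume c d :=
    fun c d hc hd => hS.intervalIntegrable_weight _ _ hc hd
  set E := Real.exp (r * (T - a)) with hE
  set N := ∫ t in 0..a, φ t with hN
  have hN0 : 0 < N :=
    intervalIntegral.intervalIntegral_pos_of_pos (hφc.intervalIntegrable _ _) hφ0 ha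
  have hP : ∀ t, HasDerivAt (fun t => (∫ s in 0..t, φ s) / N) (φ t / N) t := fun t =>
    (hφc.integral_hasStrictDerivAt 0 t).hasDerivAt.div_const N
  have hQ : ∀ t, HasDerivAt (fun t => Real.exp (r * (t - a))) (r * Real.exp (r * (t - a))) t :=
    fun t => by
      simpa [mul_comm] using (((hasDerivAt_id t).sub_const a).const_mul r).exp
  have hU : ∀ t, HasDerivAt (fun t => E * (L + 1 - t)) (-E) t := fun t => by
    simpa using ((hasDerivAt_id t).const_sub (L + 1)).const_mul E
  set χ : ℝ → ℝ := glue a (fun t => (∫ s in 0..t, φ s) / N)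
    (glue T (fun t => Real.exp (r * (t - a))) (glue L (fun _ => E) fun t => E * (L + 1 - t)))
    with hχ
  set ψ : ℝ → ℝ := glue a (fun t => φ t / N)
    (glue T (fun t => r * Real.exp (r * (t - a))) (glue L (fun _ => 0) fun _ => -E)) with hψ
  have hχc : Continuous χ := by
    refine (continuous_iff_continuousAt.2 fun t => (hP t).continuousAt).glue
      (Continuous.glue (by fun_prop) (Continuous.glue (by fun_prop) (by fun_prop) ?_) ?_) ?_
    · ring
    · rw [glue_of_le _ _ hTL]
    · rw [glue_of_le _ _ haT]
      simp [← hN, hN0.ne']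
  have hψm : Measurable ψ :=
    (hφc.div_const N).measurable.glue (Measurable.glue (by fun_prop)
      (Measurable.glue (by fun_prop) (by fun_prop)))
  have hbdd : ∀ {f : ℝ → ℝ}, Continuous f → ∃ C, ∀ t ∈ Icc 0 (L + 1), |f t| ≤ C :=
    fun hf => isCompact_Icc.exists_bound_of_continuousOn hf.continuousOn
  obtain ⟨C, hC⟩ : ∃ C, ∀ t ∈ Icc 0 (L + 1), |ψ t| ≤ C :=
    exists_abs_glue_le (hbdd (hφc.div_const N)) (exists_abs_glue_le (hbdd (by fun_prop))
      (exists_abs_glue_le (hbdd (by fun_prop)) (hbdd (by fun_prop))))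
  have hd : ∀ t ∈ Ioo 0 (L + 1) \ {a, T, L}, HasDerivAt χ (ψ t) t := by
    rintro t ⟨-, ht⟩
    simp only [mem_insert_iff, mem_singleton_iff, not_or] at ht
    have h1 : HasDerivAt (fun _ : ℝ => E) ((fun _ => 0) t) t := hasDerivAt_const t E
    exact HasDerivAt.glue (f' := fun t => φ t / N) (hP t)
      (HasDerivAt.glue (f' := fun t => r * Real.exp (r * (t - a))) (hQ t)
        (HasDerivAt.glue (g' := fun _ => -E) h1 (hU t) ht.2.2) ht.2.1) ht.1
  have key := hA.energy_le hS hr hres x hL1 (Set.toFinite {a, T, L}).countable hχc.continuousOn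
    (by rw [hχ, glue_of_le _ _ ha.le]; simp)
    (by
      rw [hχ, glue_of_lt _ _ (by linarith), glue_of_lt _ _ (by linarith),
        glue_of_lt _ _ (by linarith)]
      ring) hψm hC hd
  obtain ⟨C', hC'⟩ := hbdd hχc
  have hψi := hS.intervalIntegrable_sq_mul_weight (x : H) ω hL1 hψm.aestronglyMeasurable hC
  have hχi := hS.intervalIntegrable_sq_mul_weight (x : H) ω hL1 hχc.aestronglyMeasurable hC'
  have split : ∀ {k : ℝ → ℝ}, IntervalIntegrable (fun t => k t ^ 2 * g t) volume 0 (L + 1) →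
      ∫ t in 0..(L + 1), k t ^ 2 * g t = (∫ t in 0..a, k t ^ 2 * g t) +
        (∫ t in a..T, k t ^ 2 * g t) + (∫ t in T..L, k t ^ 2 * g t) +
        ∫ t in L..(L + 1), k t ^ 2 * g t := by
    intro k hk
    have hsub : ∀ c d, 0 ≤ c → c ≤ d → d ≤ L + 1 →
        IntervalIntegrable (fun t => k t ^ 2 * g t) volume c d := fun c d hc hcd hdL =>
      hk.mono_set (by
        rw [uIcc_of_le hcd, uIcc_of_le hL1]
        exact Icc_subset_Icc hc hdL)
    rw [intervalIntegral.integral_add_adjacent_intervals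
        (hsub _ _ le_rfl ha.le (by linarith)) (hsub _ _ ha.le haT (by linarith)),
      intervalIntegral.integral_add_adjacent_intervals
        (hsub _ _ le_rfl hT (by linarith)) (hsub _ _ hT hTL (by linarith)),
      intervalIntegral.integral_add_adjacent_intervals
        (hsub _ _ le_rfl hL (by linarith)) (hsub _ _ hL (by linarith) le_rfl)]
  have hcongr : ∀ {c d : ℝ} {f₁ f₂ : ℝ → ℝ}, c ≤ d → (∀ t, c < t → t ≤ d → f₁ t = f₂ t) →
      ∫ t in c..d, f₁ t = ∫ t in c..d, f₂ t := by
    intro c d f₁ f₂ hcd h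
    refine intervalIntegral.integral_congr_ae (Filter.Eventually.of_forall fun t ht => ?_)
    rw [uIoc_of_le hcd] at ht
    exact h t ht.1 ht.2
  have h0 : 0 ≤ ∫ t in 0..a, χ t ^ 2 * g t :=
    intervalIntegral.integral_nonneg ha.le fun t _ => mul_nonneg (sq_nonneg _) (hg0 t)
  have h3 : 0 ≤ ∫ t in L..(L + 1), χ t ^ 2 * g t :=
    intervalIntegral.integral_nonneg (by linarith) fun t _ => mul_nonneg (sq_nonneg _) (hg0 t)
  have h2 : ∫ t in T..L, χ t ^ 2 * g t = E ^ 2 * ∫ t in T..L, g t := by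
    rw [← intervalIntegral.integral_const_mul]
    refine hcongr hTL fun t ht1 ht2 => ?_
    rw [hχ, glue_of_lt _ _ (haT.trans_lt ht1), glue_of_lt _ _ ht1, glue_of_le _ _ ht2]
  have h1 : ∫ t in a..T, ψ t ^ 2 * g t = r ^ 2 * ∫ t in a..T, χ t ^ 2 * g t := by
    rw [← intervalIntegral.integral_const_mul]
    refine hcongr haT fun t ht1 ht2 => ?_
    rw [hχ, hψ, glue_of_lt _ _ ht1, glue_of_lt _ _ ht1, glue_of_le _ _ ht2, glue_of_le _ _ ht2]
    ring
  have h2' : ∫ t in T..L, ψ t ^ 2 * g t = 0 := by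
    rw [hcongr (f₂ := fun _ => 0) hTL fun t ht1 ht2 => ?_]
    · simp
    · rw [hψ, glue_of_lt _ _ (haT.trans_lt ht1), glue_of_lt _ _ ht1, glue_of_le _ _ ht2]
      simp
  have h3' : ∫ t in L..(L + 1), ψ t ^ 2 * g t ≤ E ^ 2 * B := by
    rw [hcongr (f₂ := fun t => E ^ 2 * g t) (by linarith) fun t ht1 ht2 => ?_]
    · have := intervalIntegral.integral_mono_on (μ := volume) (by linarith : L ≤ L + 1)
        ((hgi L (L + 1) hL hL1).const_mul (E ^ 2))
        (intervalIntegrable_const (c := E ^ 2 * B))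
        fun t ht => mul_le_mul_of_nonneg_left (hB t ht) (sq_nonneg E)
      simpa using this
    · rw [hψ, glue_of_lt _ _ ((haT.trans hTL).trans_lt ht1), glue_of_lt _ _ (hTL.trans_lt ht1),
        glue_of_lt _ _ ht1, neg_sq]
  have h0' : ∫ t in 0..a, ψ t ^ 2 * g t ≤ ‖(x : H)‖ ^ 2 / N := by
    rw [hcongr (f₂ := fun t => (φ t / N) ^ 2 * g t) ha.le fun t ht1 ht2 => by
      rw [hψ, glue_of_le _ _ ht2]]
    calc ∫ t in 0..a, (φ t / N) ^ 2 * g t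
        ≤ ∫ t in 0..a, (‖(x : H)‖ ^ 2 / N ^ 2) * φ t := by
          refine intervalIntegral.integral_mono_on ha.le ?_
            ((hφc.intervalIntegrable _ _).const_mul _) fun t ht => ?_
          · exact (hgi 0 a le_rfl ha.le).continuousOn_mul (by fun_prop)
          · have := mul_le_mul_of_nonneg_left (hφ t ht.1)
              (by have := hφ0 t; positivity : 0 ≤ φ t / N ^ 2)
            calc (φ t / N) ^ 2 * g t = φ t / N ^ 2 * (φ t * g t) := by ring
              _ ≤ _ := this
              _ = _ := by ring
      _ = ‖(x : H)‖ ^ 2 / N := by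
          rw [intervalIntegral.integral_const_mul, ← hN]
          field_simp
  rw [split hψi, split hχi, h1, h2, h2'] at key
  nlinarith [mul_nonneg (sq_nonneg r) h0, mul_nonneg (sq_nonneg r) h3]

/-- The cutoff error vanishes for semigroups whose growth rate lies below `ω`. -/
theorem IsGenerator.integral_weight_le_of_growth (hS : IsC0Semigroup S) (hA : IsGenerator S D A)
    (hr : 0 < r) (hres : ResolventBound D A ω r) {σ C : ℝ} (hσ : σ < ω)
    (hgrowth : ∀ t, 0 ≤ t → ‖S t‖ ≤ C * Real.exp (σ * t)) (x : D) {φ : ℝ → ℝ}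
    (hφc : Continuous φ) (hφ0 : ∀ t, 0 < φ t)
    (hφ : ∀ t, 0 ≤ t → φ t * (Real.exp (-2 * ω * t) * ‖S t (x : H)‖ ^ 2) ≤ ‖(x : H)‖ ^ 2)
    {a T L : ℝ} (ha : 0 < a) (haT : a ≤ T) (hTL : T ≤ L) :
    r ^ 2 * (Real.exp (r * (T - a)) ^ 2 *
      ∫ t in T..L, Real.exp (-2 * ω * t) * ‖S t (x : H)‖ ^ 2) ≤
      ‖(x : H)‖ ^ 2 / (∫ t in 0..a, φ t) := by
  have hT : 0 ≤ T := ha.le.trans haT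
  set B : ℝ → ℝ := fun s => (C * ‖(x : H)‖) ^ 2 * Real.exp (-(2 * (ω - σ)) * s) with hB
  have hBg : ∀ t, 0 ≤ t → Real.exp (-2 * ω * t) * ‖S t (x : H)‖ ^ 2 ≤ B t := by
    intro t ht
    have h1 : ‖S t (x : H)‖ ≤ C * Real.exp (σ * t) * ‖(x : H)‖ :=
      (S t).le_of_opNorm_le (hgrowth t ht) x
    calc Real.exp (-2 * ω * t) * ‖S t (x : H)‖ ^ 2
        ≤ Real.exp (-2 * ω * t) * (C * Real.exp (σ * t) * ‖(x : H)‖) ^ 2 := by gcongr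
      _ = (C * ‖(x : H)‖) ^ 2 * (Real.exp (-2 * ω * t) * Real.exp (σ * t) ^ 2) := by ring
      _ = B t := by
        rw [← Real.exp_nat_mul, ← Real.exp_add, hB]
        congr 2
        push_cast
        ring
  have hB0 : Filter.Tendsto B Filter.atTop (nhds 0) := by
    have h1 : Filter.Tendsto (fun s => -(2 * (ω - σ)) * s) Filter.atTop Filter.atBot :=
      Filter.tendsto_id.const_mul_atTop_of_neg (by linarith)
    have h2 := (Real.tendsto_exp_atBot.comp h1).const_mul ((C * ‖(x : H)‖) ^ 2)
    rw [mul_zero] at h2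
    exact h2
  have hlim : Filter.Tendsto (fun s => ‖(x : H)‖ ^ 2 / (∫ t in 0..a, φ t) +
      Real.exp (r * (T - a)) ^ 2 * B s) Filter.atTop
      (nhds (‖(x : H)‖ ^ 2 / (∫ t in 0..a, φ t))) := by
    simpa using (hB0.const_mul (Real.exp (r * (T - a)) ^ 2)).const_add
      (‖(x : H)‖ ^ 2 / (∫ t in 0..a, φ t))
  refine ge_of_tendsto hlim ?_
  filter_upwards [Filter.eventually_ge_atTop L] with s hs
  have hi := fun c d hc hd => hS.intervalIntegrable_weight (x : H) ω (c := c) (d := d) hc hd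
  have hs0 : 0 ≤ s := hT.trans (hTL.trans hs)
  refine le_trans ?_ (hA.integral_weight_le hS hr hres x hφc hφ0 hφ ha haT (hTL.trans hs)
    fun t ht => (hBg t (hs0.trans ht.1)).trans ?_)
  · gcongr
    rw [← intervalIntegral.integral_add_adjacent_intervals (hi T L hT (hT.trans hTL))
      (hi L s (hT.trans hTL) hs0), le_add_iff_nonneg_right]
    exact intervalIntegral.integral_nonneg hs fun t _ => by positivity
  · have := mul_le_mul_of_nonneg_left ht.1 (by linarith : 0 ≤ 2 * (ω - σ))
    simp only [hB]
    gcongr ?_ * Real.exp ?_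
    linarith

/-- The semigroup bound, for semigroups already known to have growth rate below `ω`. -/
theorem IsGenerator.norm_le_of_growth (hS : IsC0Semigroup S) (hA : IsGenerator S D A)
    (hr : 0 < r) (hres : ResolventBound D A ω r) {σ C : ℝ} (hσ : σ < ω)
    (hgrowth : ∀ t, 0 ≤ t → ‖S t‖ ≤ C * Real.exp (σ * t))
    {m : ℝ → ℝ} (hm_cont : ContinuousOn m (Ici 0)) (hm_pos : ∀ t, 0 ≤ t → 0 < m t)
    (hm_bound : ∀ t, 0 ≤ t → ‖S t‖ ≤ m t) {a b t : ℝ} (ha : 0 < a) (hb : 0 < b)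
    (ht : a + b ≤ t) :
    ‖S t‖ ≤ Real.exp (ω * t - r * (t - a - b)) /
      (r * √(∫ s in 0..a, Real.exp (2 * ω * s) / m s ^ 2) *
        √(∫ s in 0..b, Real.exp (2 * ω * s) / m s ^ 2)) := by
  set φ : ℝ → ℝ := fun s => Real.exp (2 * ω * s) / m (max s 0) ^ 2 with hφ
  have hmc : Continuous fun s => m (max s 0) :=
    hm_cont.comp_continuous (by fun_prop) fun s => mem_Ici.2 (le_max_right _ _)
  have hmp : ∀ s, 0 < m (max s 0) := fun s => hm_pos _ (le_max_right _ _)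
  have hφc : Continuous φ :=
    Continuous.div (by fun_prop) (hmc.pow 2) fun s => (pow_pos (hmp s) 2).ne'
  have hφ0 : ∀ s, 0 < φ s := fun s => div_pos (Real.exp_pos _) (pow_pos (hmp s) 2)
  have hN : ∀ {c : ℝ}, 0 ≤ c →
      ∫ s in 0..c, Real.exp (2 * ω * s) / m s ^ 2 = ∫ s in 0..c, φ s := by
    intro c hc
    refine intervalIntegral.integral_congr fun s hs => ?_
    rw [uIcc_of_le hc] at hs
    simp only [hφ, max_eq_left hs.1]
  rw [hN ha.le, hN hb.le]
  set Na := ∫ s in 0..a, φ s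
  set Nb := ∫ s in 0..b, φ s with hNb
  have hNa0 : 0 < Na :=
    intervalIntegral.intervalIntegral_pos_of_pos (hφc.intervalIntegrable _ _) hφ0 ha
  have hNb0 : 0 < Nb :=
    intervalIntegral.intervalIntegral_pos_of_pos (hφc.intervalIntegrable _ _) hφ0 hb
  refine (S t).opNorm_le_bound (by positivity) fun y => ?_
  refine hA.dense.induction (P := fun y => ‖S t y‖ ≤ _ * ‖y‖) (fun x hx => ?_)
    (isClosed_le (by fun_prop) (by fun_prop)) y
  have hle : ∀ s, 0 ≤ s → ∀ z, ‖S s z‖ ≤ m s * ‖z‖ := fun s hs z =>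
    (S s).le_of_opNorm_le (hm_bound s hs) z
  have hφx : ∀ s, 0 ≤ s → φ s * (Real.exp (-2 * ω * s) * ‖S s x‖ ^ 2) ≤ ‖x‖ ^ 2 := by
    intro s hs
    have hms := hm_pos s hs
    calc φ s * (Real.exp (-2 * ω * s) * ‖S s x‖ ^ 2)
        = (Real.exp (2 * ω * s) * Real.exp (-2 * ω * s)) * ‖S s x‖ ^ 2 / m s ^ 2 := by
          simp only [hφ, max_eq_left hs]
          ring
      _ = ‖S s x‖ ^ 2 / m s ^ 2 := by
          rw [← Real.exp_add]
          ring_nf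
          simp
      _ ≤ ‖x‖ ^ 2 := by
          rw [div_le_iff₀ (by positivity), ← mul_pow, mul_comm]
          exact pow_le_pow_left₀ (norm_nonneg _) (hle s hs x) 2
  have h1 := hA.integral_weight_le_of_growth hS hr hres hσ hgrowth ⟨x, hx⟩ hφc hφ0 hφx ha
    (by linarith : a ≤ t - b) (by linarith : t - b ≤ t)
  have h2 : Real.exp (-2 * ω * t) * ‖S t x‖ ^ 2 * Nb ≤
      ∫ s in (t - b)..t, Real.exp (-2 * ω * s) * ‖S s x‖ ^ 2 := by
    have h3 : Nb = ∫ s in (t - b)..t, φ (t - s) := by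
      rw [intervalIntegral.integral_comp_sub_left (fun s => φ s) t]
      simp [hNb]
    rw [h3, ← intervalIntegral.integral_const_mul]
    refine intervalIntegral.integral_mono_on (by linarith)
      (Continuous.intervalIntegrable (by fun_prop) _ _)
      (hS.intervalIntegrable_weight x ω (by linarith) (by linarith)) fun s hs => ?_
    have hs0 : 0 ≤ s := by linarith [hs.1]
    have hts : 0 ≤ t - s := by linarith [hs.2]
    have hms := hm_pos _ hts
    have h4 : ‖S t x‖ ≤ m (t - s) * ‖S s x‖ := by
      have h5 := hS.map_add (t - s) hts s hs0
      rw [sub_add_cancel] at h5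
      rw [h5]
      exact hle _ hts _
    calc Real.exp (-2 * ω * t) * ‖S t x‖ ^ 2 * φ (t - s)
        = (Real.exp (-2 * ω * t) * Real.exp (2 * ω * (t - s))) *
            (‖S t x‖ ^ 2 / m (t - s) ^ 2) := by
          simp only [hφ, max_eq_left hts]
          ring
      _ = Real.exp (-2 * ω * s) * (‖S t x‖ ^ 2 / m (t - s) ^ 2) := by
          rw [← Real.exp_add]
          ring_nf
      _ ≤ Real.exp (-2 * ω * s) * ‖S s x‖ ^ 2 := by
          gcongr
          rw [div_le_iff₀ (by positivity), ← mul_pow, mul_comm]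
          exact pow_le_pow_left₀ (norm_nonneg _) h4 2
  have hE : Real.exp (ω * t - r * (t - a - b)) =
      Real.exp (ω * t) / Real.exp (r * (t - b - a)) := by
    rw [← Real.exp_sub]
    ring_nf
  have hE2 : Real.exp (-2 * ω * t) = (Real.exp (ω * t) ^ 2)⁻¹ := by
    rw [← Real.exp_nat_mul, ← Real.exp_neg]
    push_cast
    ring_nf
  rw [hE]
  rw [hE2] at h2
  set E := Real.exp (r * (t - b - a)) with hEdef
  set F := Real.exp (ω * t) with hFdef
  have hE0 : 0 < E := Real.exp_pos _
  have hF0 : 0 < F := Real.exp_pos _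
  have h6 : r ^ 2 * (E ^ 2 * ((F ^ 2)⁻¹ * ‖S t x‖ ^ 2 * Nb)) ≤ ‖x‖ ^ 2 / Na :=
    le_trans (by gcongr) h1
  refine (sq_le_sq₀ (norm_nonneg _) (by positivity)).1 ?_
  rw [mul_pow, div_pow, div_pow, mul_pow, mul_pow, Real.sq_sqrt hNa0.le, Real.sq_sqrt hNb0.le]
  rw [le_div_iff₀ hNa0] at h6
  calc ‖S t x‖ ^ 2 = F ^ 2 / E ^ 2 / (r ^ 2 * Na * Nb) *
        (r ^ 2 * (E ^ 2 * ((F ^ 2)⁻¹ * ‖S t x‖ ^ 2 * Nb)) * Na) := by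
        field_simp
    _ ≤ _ := by gcongr

/-- A resolvent bound `1 / r` on `Re z > ω` pushes the growth rate of the semigroup below `ω`. -/
theorem IsGenerator.exists_growth_bound_lt (hS : IsC0Semigroup S) (hA : IsGenerator S D A)
    (hr : 0 < r) (hres : ResolventBound D A ω r)
    {m : ℝ → ℝ} (hm_cont : ContinuousOn m (Ici 0)) (hm_pos : ∀ t, 0 ≤ t → 0 < m t)
    (hm_bound : ∀ t, 0 ≤ t → ‖S t‖ ≤ m t) :
    ∃ σ < ω, ∃ C : ℝ, ∀ t, 0 ≤ t → ‖S t‖ ≤ C * Real.exp (σ * t) := by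
  obtain ⟨M, hM⟩ := (isCompact_Icc (a := (0 : ℝ)) (b := 2)).exists_bound_of_continuousOn
    (hm_cont.mono Icc_subset_Ici_self)
  have hSM : ∀ t ∈ Icc (0 : ℝ) 2, ‖S t‖ ≤ M := fun t ht =>
    (hm_bound t ht.1).trans ((le_abs_self _).trans (hM t ht))
  obtain ⟨K, hK⟩ := hS.exists_growth_bound fun t (ht : t ∈ Icc (0 : ℝ) 1) =>
    hSM t ⟨ht.1, ht.2.trans one_le_two⟩
  have step : ∀ n : ℕ, ∃ σ, (σ < ω ∨ σ ≤ K - n * (r / 2)) ∧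
      ∃ C : ℝ, ∀ t, 0 ≤ t → ‖S t‖ ≤ C * Real.exp (σ * t) := by
    intro n
    induction n with
    | zero => exact ⟨K, Or.inr (by simp), hK⟩
    | succ n ih =>
      obtain ⟨σ, hσ, C, hC⟩ := ih
      by_cases hσω : σ < ω
      · exact ⟨σ, Or.inl hσω, C, hC⟩
      refine ⟨σ - r / 2, Or.inr ?_, ?_⟩
      · have := hσ.resolve_left hσω
        push_cast
        linarith
      have hcore := fun t ht => hA.norm_le_of_growth hS hr
        (hres.mono (by linarith : ω ≤ σ + r / 2)) (by linarith : σ < σ + r / 2) hC hm_cont hm_pos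
        hm_bound zero_lt_one zero_lt_one (t := t) ht
      set Q := r * √(∫ s in (0 : ℝ)..1, Real.exp (2 * (σ + r / 2) * s) / m s ^ 2) *
        √(∫ s in (0 : ℝ)..1, Real.exp (2 * (σ + r / 2) * s) / m s ^ 2) with hQ
      have hQ0 : 0 ≤ Q := by positivity
      have hM0 : 0 ≤ M := (norm_nonneg _).trans (hSM 0 (by simp))
      refine ⟨Real.exp (2 * r) / Q + M * Real.exp (2 * |σ - r / 2|), fun t ht => ?_⟩
      rw [add_mul]
      rcases le_total t 2 with h | h
      · refine le_add_of_nonneg_of_le (by positivity) ((hSM t ⟨ht, h⟩).trans ?_)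
        rw [mul_assoc, ← Real.exp_add]
        refine le_mul_of_one_le_right hM0 (Real.one_le_exp ?_)
        nlinarith [neg_abs_le (σ - r / 2), abs_nonneg (σ - r / 2)]
      · refine le_add_of_le_of_nonneg ((hcore t (by linarith)).trans (le_of_eq ?_))
          (by positivity)
        rw [div_mul_eq_mul_div, ← Real.exp_add]
        ring_nf
  obtain ⟨n, hn⟩ := exists_nat_gt ((K - ω) / (r / 2))
  obtain ⟨σ, hσ, hC⟩ := step n
  rw [div_lt_iff₀ (by positivity)] at hn
  exact ⟨σ, hσ.elim id fun h => by linarith, hC⟩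

end Semigroup

theorem statement0 {H : Type*} [NormedAddCommGroup H] [InnerProductSpace ℂ H] [CompleteSpace H]
    (S : ℝ → H →L[ℂ] H) (D : Submodule ℂ H) (A : D →ₗ[ℂ] H)
    (hS : IsC0Semigroup S) (hA : IsGenerator S D A)
    (ω r : ℝ) (hr : 0 < r) (hres : ResolventBound D A ω r)
    (m : ℝ → ℝ) (hm_cont : ContinuousOn m (Ici 0)) (hm_pos : ∀ t, 0 ≤ t → 0 < m t)
    (hm_bound : ∀ t, 0 ≤ t → ‖S t‖ ≤ m t) :
    ∀ (a : ℝ), 0 < a → ∀ (b : ℝ), 0 < b → ∀ (t : ℝ), a + b ≤ t →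
      ‖S t‖ ≤ Real.exp (ω * t - r * (t - a - b)) /
        (r * Real.sqrt (∫ s in (0:ℝ)..a, Real.exp (2 * ω * s) / m s ^ 2)
           * Real.sqrt (∫ s in (0:ℝ)..b, Real.exp (2 * ω * s) / m s ^ 2)) := by
  intro a ha b hb t ht
  obtain ⟨σ, hσ, C, hC⟩ := hA.exists_growth_bound_lt hS hr hres hm_cont hm_pos hm_bound
  exact hA.norm_le_of_growth hS hr hres hσ hC hm_cont hm_pos hm_bound ha hb ht
end

section
/- Let S(t) be a strongly continuous one-parameter semigroup on a complex Hilbert space H with generator A, and let m : [0,∞) → (0,∞) be a continuous positive function with ‖S(t)‖ ≤ m(t) for all t ≥ 0. Let C : D(A) → H be a linear map such that C(S(t)x) = S(t)(C x) for all x ∈ D(A) and t ≥ 0. Let ω ∈ ℝ and r_C > 0 be such that for every z ∈ ℂ with Re z ≥ ω the operator z − A : D(A) → H is bijective and ‖C x‖ ≤ (1/r_C) ‖z x − A x‖ for all x ∈ D(A) (i.e. ‖C (z−A)^{−1}‖ ≤ 1/r_C). Then for all a, b > 0 and all t ≥ a + b, the map x ↦ C(S(t)x) extends from D(A) to a bounded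 linear operator T_t on H with ‖T_t‖ ≤ e^{ωt} / ( r_C · N_a(m,ω) · N_b(m,ω) ), where N_c(m,ω) := (∫₀^c e^{2ωs} m(s)^{−2} ds)^{1/2}. -/
open Set MeasureTheory

open scoped FourierTransform Topology
open Filter

section Plancherel

variable {H : Type*} [NormedAddCommGroup H] [InnerProductSpace ℂ H]

theorem continuous_fourier_of_integrable {f : ℝ → H} (hf : Integrable f) : Continuous (𝓕 f) :=
  VectorFourier.fourierIntegral_continuous Real.continuous_fourierChar
    (by fun_prop) hf

theorem integrable_inner_of_memLp_two {α : Type*} [MeasurableSpace α] {μ : Measure α}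
    {f g : α → H} (hf : MemLp f 2 μ) (hg : MemLp g 2 μ) :
    Integrable (fun x => inner ℂ (f x) (g x)) μ :=
  (hf.norm.integrable_mul hg.norm).mono' (hf.aestronglyMeasurable.inner hg.aestronglyMeasurable)
    (.of_forall fun x => norm_inner_le_norm (f x) (g x))

theorem norm_integral_inner_le {α : Type*} [MeasurableSpace α] {μ : Measure α} {f g : α → H}
    (hf : MemLp f 2 μ) (hg : MemLp g 2 μ) :
    ‖∫ x, inner ℂ (f x) (g x) ∂μ‖ ≤ √(∫ x, ‖f x‖ ^ 2 ∂μ) * √(∫ x, ‖g x‖ ^ 2 ∂μ) := by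
  refine (norm_integral_le_integral_norm _).trans ?_
  have h := integral_mul_le_Lp_mul_Lq_of_nonneg (μ := μ) Real.HolderConjugate.two_two
    (f := fun x => ‖f x‖) (g := fun x => ‖g x‖) (.of_forall fun _ => norm_nonneg _)
    (.of_forall fun _ => norm_nonneg _) (by simpa using hf.norm) (by simpa using hg.norm)
  simp only [Real.rpow_ofNat, ← Real.sqrt_eq_rpow] at h
  refine (integral_mono_of_nonneg (.of_forall fun _ => norm_nonneg _) ?_
    (.of_forall fun x => norm_inner_le_norm (f x) (g x))).trans h
  exact hf.norm.integrable_mul hg.norm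

variable [CompleteSpace H]

theorem integral_fourier_smul_eq_flip {f : ℝ → ℂ} {g : ℝ → H} (hf : Integrable f)
    (hg : Integrable g) : ∫ ξ, 𝓕 f ξ • g ξ = ∫ x, f x • 𝓕 g x := by
  have := VectorFourier.integral_fourierIntegral_smul_eq_flip (L := innerₗ ℝ)
    Real.continuous_fourierChar continuous_inner hf hg
  rwa [flip_innerₗ] at this

theorem fourier_toLp_ae_eq {f : ℝ → H} (hf : Integrable f) (hf2 : MemLp f 2) :
    (𝓕 (hf2.toLp f) : Lp H 2) =ᵐ[volume] 𝓕 f := by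
  refine ae_eq_of_integral_contDiff_smul_eq
    ((Lp.memLp (𝓕 (hf2.toLp f))).locallyIntegrable (by norm_num))
    (continuous_fourier_of_integrable hf).locallyIntegrable fun g hg hgc => ?_
  have h₂ : HasCompactSupport (Complex.ofRealCLM ∘ g) := hgc.comp_left rfl
  let φ : SchwartzMap ℝ ℂ := h₂.toSchwartzMap (Complex.ofRealCLM.contDiff.comp hg)
  have hφ : ∀ x, φ x = (g x : ℂ) := fun x => rfl
  have key := congrArg (fun T => T φ) (Lp.fourier_toTemperedDistribution_eq (hf2.toLp f))
  simp only [TemperedDistribution.fourier_apply, Lp.toTemperedDistribution_apply, hφ] at key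
  have h1 : ∫ x, 𝓕 φ x • hf2.toLp f x = ∫ x, 𝓕 φ x • f x :=
    integral_congr_ae (by filter_upwards [hf2.coeFn_toLp] with x hx; rw [hx])
  have h2 := integral_fourier_smul_eq_flip φ.integrable hf
  rw [← SchwartzMap.fourier_coe] at h2
  rw [h1, h2] at key
  simpa [hφ] using key.symm

theorem memLp_two_fourier {f : ℝ → H} (hf : Integrable f) (hf2 : MemLp f 2) :
    MemLp (𝓕 f) 2 :=
  (Lp.memLp _).ae_eq (fourier_toLp_ae_eq hf hf2)

theorem integral_inner_fourier {f g : ℝ → H} (hf : Integrable f) (hf2 : MemLp f 2)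
    (hg : Integrable g) (hg2 : MemLp g 2) :
    ∫ ξ, inner ℂ (𝓕 f ξ) (𝓕 g ξ) = ∫ x, inner ℂ (f x) (g x) := by
  have := Lp.inner_fourier_eq (hf2.toLp f) (hg2.toLp g)
  rw [L2.inner_def, L2.inner_def] at this
  calc _ = _ := integral_congr_ae (by
          filter_upwards [fourier_toLp_ae_eq hf hf2, fourier_toLp_ae_eq hg hg2] with x hx hy
          rw [hx, hy])
    _ = _ := this
    _ = _ := integral_congr_ae (by
          filter_upwards [hf2.coeFn_toLp, hg2.coeFn_toLp] with x hx hy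
          rw [hx, hy])

theorem integral_norm_sq_fourier {f : ℝ → H} (hf : Integrable f) (hf2 : MemLp f 2) :
    ∫ ξ, ‖𝓕 f ξ‖ ^ 2 = ∫ x, ‖f x‖ ^ 2 := by
  apply Complex.ofRealLI.injective
  simpa [← LinearIsometry.integral_comp_comm, inner_self_eq_norm_sq_to_K] using
    integral_inner_fourier hf hf2 hf hf2

end Plancherel

section HalfPlane

variable {E : Type*} [NormedAddCommGroup E] [NormedSpace ℂ E]

theorem integral_exp_neg_mul_le (ω N : ℝ) {τ : ℝ} (hτ : 0 < τ) :
    ∫ σ in ω..N, Real.exp (-τ * σ) ≤ Real.exp (-τ * ω) / τ := by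
  have h : ∫ σ in ω..N, Real.exp (-τ * σ) = (Real.exp (-τ * ω) - Real.exp (-τ * N)) / τ := by
    rw [intervalIntegral.integral_comp_mul_left _ (neg_ne_zero.2 hτ.ne'), integral_exp, smul_eq_mul]
    field_simp
    ring
  rw [h]
  gcongr
  linarith [Real.exp_pos (-τ * N)]

theorem norm_integral_horizontal_le {ω N M T τ y : ℝ} {k : ℂ → E} (hN : ω ≤ N) (hτ : 0 < τ)
    (hT : 0 < T) (hy : |y| = T) (hM : ∀ z : ℂ, ω ≤ z.re → ‖z‖ * ‖k z‖ ≤ M) :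
    ‖∫ σ in ω..N, Complex.exp (-τ * (σ + y * Complex.I)) • k (σ + y * Complex.I)‖ ≤
      M / T * (Real.exp (-τ * ω) / τ) := by
  have hM0 : 0 ≤ M := le_trans (by positivity) (hM ω (by simp))
  calc _ ≤ ∫ σ in ω..N, M / T * Real.exp (-τ * σ) := by
        refine intervalIntegral.norm_integral_le_of_norm_le hN (.of_forall fun σ hσ => ?_)
          (Continuous.intervalIntegrable (by fun_prop) _ _)
        rw [norm_smul, Complex.norm_exp, mul_comm]
        have h1 : (-(τ : ℂ) * (σ + y * Complex.I)).re = -τ * σ := by simp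
        rw [h1]
        gcongr
        rw [le_div_iff₀ hT, mul_comm]
        refine le_trans ?_ (hM (σ + y * Complex.I) (by simpa using hσ.1.le))
        gcongr
        rw [← hy]
        simpa using Complex.abs_im_le_norm (σ + y * Complex.I)
    _ ≤ _ := by
        rw [intervalIntegral.integral_const_mul]
        gcongr
        exact integral_exp_neg_mul_le ω N hτ

/-- A bounded holomorphic function on a half-plane which decays like `1 / ‖z‖` has truncated
inverse Laplace integrals at negative times that tend to zero. -/
theorem norm_integral_vertical_le {ω B M T τ : ℝ} {k : ℂ → E} (hτ : 0 < τ) (hT : 0 < T)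
    (hk : DifferentiableOn ℂ k {z | ω ≤ z.re}) (hB : ∀ z : ℂ, ω ≤ z.re → ‖k z‖ ≤ B)
    (hM : ∀ z : ℂ, ω ≤ z.re → ‖z‖ * ‖k z‖ ≤ M) :
    ‖∫ y in -T..T, Complex.exp (-τ * (ω + y * Complex.I)) • k (ω + y * Complex.I)‖ ≤
      2 * (M / T * (Real.exp (-τ * ω) / τ)) := by
  have key : ∀ N, ω ≤ N →
      ‖∫ y in -T..T, Complex.exp (-τ * (ω + y * Complex.I)) • k (ω + y * Complex.I)‖ ≤
        2 * (M / T * (Real.exp (-τ * ω) / τ)) + Real.exp (-τ * N) * B * |T - -T| := by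
    intro N hN
    have hrect := Complex.integral_boundary_rect_eq_zero_of_differentiableOn
      (fun z => Complex.exp (-τ * z) • k z) ⟨ω, -T⟩ ⟨N, T⟩ (by
        refine DifferentiableOn.smul (by fun_prop) (hk.mono fun z hz => ?_)
        have := hz.1
        simp only [uIcc_of_le hN, mem_preimage, mem_Icc] at this
        exact this.1)
    simp only at hrect
    have hbot := norm_integral_horizontal_le (y := -T) hN hτ hT (by simp [hT.le]) hM
    have htop := norm_integral_horizontal_le (y := T) hN hτ hT (by simp [hT.le]) hM
    have hright : ‖∫ y in -T..T, Complex.exp (-τ * (N + y * Complex.I)) •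
        k (N + y * Complex.I)‖ ≤ Real.exp (-τ * N) * B * |T - -T| := by
      refine intervalIntegral.norm_integral_le_of_norm_le_const fun y _ => ?_
      rw [norm_smul, Complex.norm_exp]
      have h1 : (-(τ : ℂ) * (N + y * Complex.I)).re = -τ * N := by simp
      rw [h1]
      gcongr
      exact hB _ (by simpa using hN)
    have hI : ∀ v : E, ‖Complex.I • v‖ = ‖v‖ := fun v => by simp [norm_smul]
    rw [sub_eq_zero] at hrect
    rw [← hI, ← hrect]
    refine (norm_add_le _ _).trans ?_
    rw [hI]
    have := norm_sub_le
      (∫ σ in ω..N, Complex.exp (-τ * (σ + (-T : ℝ) * Complex.I)) •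
        k (σ + (-T : ℝ) * Complex.I))
      (∫ σ in ω..N, Complex.exp (-τ * (σ + T * Complex.I)) • k (σ + T * Complex.I))
    linarith
  have hlim : Tendsto (fun N : ℝ => 2 * (M / T * (Real.exp (-τ * ω) / τ)) +
      Real.exp (-τ * N) * B * |T - -T|) atTop
      (𝓝 (2 * (M / T * (Real.exp (-τ * ω) / τ)) + 0 * B * |T - -T|)) := by
    refine tendsto_const_nhds.add (Tendsto.mul_const _ (Tendsto.mul_const _ ?_))
    refine Real.tendsto_exp_atBot.comp ?_
    exact tendsto_id.const_mul_atTop_of_neg (by linarith)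
  simpa using ge_of_tendsto hlim (eventually_ge_atTop ω |>.mono key)

end HalfPlane

section Truncation

theorem memLp_indicator_Ioc {E : Type*} [NormedAddCommGroup E] {p q : ℝ} {f : ℝ → E}
    (hf : ContinuousOn f (Icc p q))
    (r : ENNReal) : MemLp ((Ioc p q).indicator f) r := by
  rw [memLp_indicator_iff_restrict measurableSet_Ioc]
  obtain ⟨B, hB⟩ := isCompact_Icc.exists_bound_of_continuousOn hf
  refine MemLp.of_bound
    ((hf.mono Ioc_subset_Icc_self).aestronglyMeasurable measurableSet_Ioc) B ?_
  filter_upwards [ae_restrict_mem measurableSet_Ioc] with s hs using hB s (Ioc_subset_Icc_self hs)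

theorem integrable_indicator_Ioc {E : Type*} [NormedAddCommGroup E] {p q : ℝ} {f : ℝ → E}
    (hf : ContinuousOn f (Icc p q)) :
    Integrable ((Ioc p q).indicator f) :=
  memLp_one_iff_integrable.1 (memLp_indicator_Ioc hf 1)

variable {H : Type*} [NormedAddCommGroup H] [InnerProductSpace ℂ H]

theorem fourier_indicator_Ioc {p q ω : ℝ} (hpq : p ≤ q) (f : ℝ → H) (ν : ℝ) :
    𝓕 ((Ioc p q).indicator fun s => Complex.exp (-ω * s) • f s) ν =
      ∫ s in p..q, Complex.exp (-(ω + (2 * Real.pi * ν : ℝ) * Complex.I) * s) • f s := by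
  rw [Real.fourier_real_eq_integral_exp_smul, intervalIntegral.integral_of_le hpq,
    ← integral_indicator measurableSet_Ioc]
  congr 1 with s
  by_cases hs : s ∈ Ioc p q
  · simp only [indicator_of_mem hs, smul_smul, ← Complex.exp_add]
    congr 2
    push_cast
    ring
  · simp [indicator_of_notMem hs]

theorem integral_norm_sq_indicator_Ioc {p q ω : ℝ} (hpq : p ≤ q) (f : ℝ → H) :
    ∫ s, ‖(Ioc p q).indicator (fun s => Complex.exp (-ω * s) • f s) s‖ ^ 2 =
      ∫ s in p..q, Real.exp (-2 * ω * s) * ‖f s‖ ^ 2 := by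
  rw [intervalIntegral.integral_of_le hpq, ← integral_indicator measurableSet_Ioc]
  congr 1 with s
  by_cases hs : s ∈ Ioc p q
  · simp only [indicator_of_mem hs, norm_smul, Complex.norm_exp, mul_pow, ← Real.exp_nat_mul]
    congr 2
    simp
    ring
  · simp [indicator_of_notMem hs]

theorem integral_inner_fourier_eq_fourierInv [CompleteSpace H] {f g : ℝ → H} (hf : Integrable f)
    (hg : Integrable g) :
    ∫ ξ, inner ℂ (𝓕 f ξ) (g ξ) = ∫ x, inner ℂ (f x) (𝓕⁻ g x) := by
  have := VectorFourier.integral_sesq_fourierIntegral_eq_neg_flip (L := innerₗ ℝ) (innerSL ℂ)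
    Real.continuous_fourierChar continuous_inner hf hg
  have h2 : ∀ x, 𝓕⁻ g x =
      VectorFourier.fourierIntegral Real.fourierChar volume (-(innerₗ ℝ).flip) g x := by
    intro x
    simp [Real.fourierInv_eq, VectorFourier.fourierIntegral]
  simp only [innerSL_apply_apply] at this
  simp_rw [h2]
  exact this

theorem norm_fourierInv_truncation_le {ω B M T L s : ℝ} {k : ℂ → H} (hs : s < L) (hT : 0 < T)
    (hk : DifferentiableOn ℂ k {z | ω ≤ z.re}) (hB : ∀ z : ℂ, ω ≤ z.re → ‖k z‖ ≤ B)
    (hM : ∀ z : ℂ, ω ≤ z.re → ‖z‖ * ‖k z‖ ≤ M) :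
    ‖𝓕⁻ ((Ioc (-T) T).indicator fun ν : ℝ =>
        Complex.exp (-(ω + (2 * Real.pi * ν : ℝ) * Complex.I) * L) •
          k (ω + (2 * Real.pi * ν : ℝ) * Complex.I)) s‖ ≤
      M * Real.exp (-ω * L) / (L - s) / T := by
  have hM0 : 0 ≤ M := le_trans (by positivity) (hM ω (by simp))
  have hπ := Real.pi_gt_three
  have hLs : 0 < L - s := sub_pos.2 hs
  set Φ : ℝ → H := fun y => Complex.exp (-(L - s : ℝ) * (ω + y * Complex.I)) •
    k (ω + y * Complex.I) with hΦ
  have h1 : 𝓕⁻ ((Ioc (-T) T).indicator fun ν : ℝ =>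
        Complex.exp (-(ω + (2 * Real.pi * ν : ℝ) * Complex.I) * L) •
          k (ω + (2 * Real.pi * ν : ℝ) * Complex.I)) s =
      Complex.exp (-ω * s) • ∫ ν in -T..T, Φ (2 * Real.pi * ν) := by
    rw [Real.fourierInv_eq', intervalIntegral.integral_of_le (by linarith),
      ← integral_smul, ← integral_indicator measurableSet_Ioc]
    congr 1 with ν
    by_cases hν : ν ∈ Ioc (-T) T
    · simp only [indicator_of_mem hν, smul_smul, ← Complex.exp_add, hΦ]
      congr 2
      simp
      ring
    · simp [indicator_of_notMem hν]
  have h2 : (2 * Real.pi) • ∫ ν in -T..T, Φ (2 * Real.pi * ν) =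
      ∫ y in -(2 * Real.pi * T)..2 * Real.pi * T, Φ y := by
    rw [intervalIntegral.smul_integral_comp_mul_left]
    simp
  have h3 : ‖∫ ν in -T..T, Φ (2 * Real.pi * ν)‖ ≤
      ‖∫ y in -(2 * Real.pi * T)..2 * Real.pi * T, Φ y‖ := by
    rw [← h2, norm_smul]
    refine le_mul_of_one_le_left (norm_nonneg _) ?_
    rw [Real.norm_of_nonneg (by positivity)]
    linarith
  have h4 := norm_integral_vertical_le (T := 2 * Real.pi * T) hLs (by positivity) hk hB hM
  rw [h1, norm_smul, Complex.norm_exp]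
  have h5 : (-(ω : ℂ) * s).re = -ω * s := by simp
  rw [h5]
  calc _ ≤ Real.exp (-ω * s) *
        (2 * (M / (2 * Real.pi * T) * (Real.exp (-(L - s) * ω) / (L - s)))) := by
        gcongr
        exact h3.trans h4
    _ = (M * Real.exp (-ω * L) / (L - s) / T) / Real.pi := by
        have h6 : Real.exp (-ω * L) = Real.exp (-ω * s) * Real.exp (-(L - s) * ω) := by
          rw [← Real.exp_add]
          congr 1
          ring
        rw [h6]
        field_simp
    _ ≤ _ := div_le_self (by positivity) (by linarith)

variable [CompleteSpace H]

theorem integral_inner_fourier_eq_zero {ω B M L p q : ℝ} {k : ℂ → H} {h : ℝ → H}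
    (hqL : q < L) (hh : ContinuousOn h (Icc p q))
    (hk : DifferentiableOn ℂ k {z | ω ≤ z.re}) (hB : ∀ z : ℂ, ω ≤ z.re → ‖k z‖ ≤ B)
    (hM : ∀ z : ℂ, ω ≤ z.re → ‖z‖ * ‖k z‖ ≤ M)
    (hE : MemLp (fun ν : ℝ => Complex.exp (-(ω + (2 * Real.pi * ν : ℝ) * Complex.I) * L) •
          k (ω + (2 * Real.pi * ν : ℝ) * Complex.I)) 2) :
    ∫ ν, inner ℂ (𝓕 ((Ioc p q).indicator h) ν)
      (Complex.exp (-(ω + (2 * Real.pi * ν : ℝ) * Complex.I) * L) •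
          k (ω + (2 * Real.pi * ν : ℝ) * Complex.I)) = 0 := by
  set e : ℝ → H := fun ν : ℝ => Complex.exp (-(ω + (2 * Real.pi * ν : ℝ) * Complex.I) * L) •
          k (ω + (2 * Real.pi * ν : ℝ) * Complex.I) with he
  have hf2 := memLp_two_fourier (integrable_indicator_Ioc hh) (memLp_indicator_Ioc hh 2)
  have hcont : Continuous e := by
    refine Continuous.smul (by fun_prop) ?_
    exact hk.continuousOn.comp_continuous (by fun_prop) fun ν => by simp
  have hint : Integrable fun ν => inner ℂ (𝓕 ((Ioc p q).indicator h) ν) (e ν) :=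
    integrable_inner_of_memLp_two hf2 hE
  have hlim := intervalIntegral_tendsto_integral hint tendsto_neg_atTop_atBot tendsto_id
  set b : ℝ → ℝ := (Ioc p q).indicator fun s =>
    ‖h s‖ * (M * Real.exp (-ω * L) / (L - s)) with hb
  have hbint : Integrable b := by
    refine integrable_indicator_Ioc (hh.norm.mul (ContinuousOn.div (by fun_prop) (by fun_prop) ?_))
    intro s hs
    linarith [hs.2]
  refine tendsto_nhds_unique hlim ?_
  refine squeeze_zero_norm' (a := fun T => (∫ s, b s) / T) ?_
    (tendsto_const_nhds.div_atTop tendsto_id)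
  filter_upwards [eventually_gt_atTop 0] with T hT
  have h1 : ∫ ν in -T..T, inner ℂ (𝓕 ((Ioc p q).indicator h) ν) (e ν) =
      ∫ s, inner ℂ ((Ioc p q).indicator h s) (𝓕⁻ ((Ioc (-T) T).indicator e) s) := by
    rw [← integral_inner_fourier_eq_fourierInv (integrable_indicator_Ioc hh)
      (integrable_indicator_Ioc hcont.continuousOn),
      intervalIntegral.integral_of_le (by linarith), ← integral_indicator measurableSet_Ioc]
    congr 1 with ν
    by_cases hν : ν ∈ Ioc (-T) T
    · simp [indicator_of_mem hν]
    · simp [indicator_of_notMem hν]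
  simp only [id]
  rw [h1, ← integral_div]
  refine norm_integral_le_of_norm_le (hbint.div_const T) (.of_forall fun s => ?_)
  by_cases hs : s ∈ Ioc p q
  · simp only [hb, indicator_of_mem hs]
    refine (norm_inner_le_norm _ _).trans ?_
    rw [mul_div_assoc]
    gcongr
    exact norm_fourierInv_truncation_le (hs.2.trans_lt hqL) hT hk hB hM
  · simp [hb, indicator_of_notMem hs]

end Truncation

section Energy

variable {H : Type*} [NormedAddCommGroup H] [InnerProductSpace ℂ H] [CompleteSpace H]

theorem integral_duhamel {z : ℂ} {K : H →L[ℂ] H} {u g : ℝ → H} {χ ψ : ℝ → ℝ} {p q : ℝ}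
    (hp : 0 ≤ p) (hpq : p ≤ q) (hu : ContinuousOn u (Ici 0)) (hg : ContinuousOn g (Ici 0))
    (hderiv : ∀ s, 0 ≤ s →
      HasDerivWithinAt (fun s => K (u s)) (z • K (u s) - g s) (Ici 0) s)
    (hχ : ContinuousOn χ (Icc p q)) (hψ : ContinuousOn ψ (Icc p q))
    (hχψ : ∀ s ∈ Ioo p q, HasDerivAt χ (ψ s) s) :
    ∫ s in p..q, Complex.exp (-z * s) • ((χ s : ℂ) • g s) =
      K (∫ s in p..q, Complex.exp (-z * s) • ((ψ s : ℂ) • u s)) -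
        (Complex.exp (-z * q) • (χ q : ℂ) • K (u q) -
          Complex.exp (-z * p) • (χ p : ℂ) • K (u p)) := by
  have hsub : Icc p q ⊆ Ici 0 := fun s hs => hp.trans hs.1
  have hu' := hu.mono hsub
  have hg' := hg.mono hsub
  have hχ' : ContinuousOn (fun s => (χ s : ℂ)) (Icc p q) := by fun_prop
  have hψ' : ContinuousOn (fun s => (ψ s : ℂ)) (Icc p q) := by fun_prop
  have i1 : IntervalIntegrable (fun s => Complex.exp (-z * s) • ((ψ s : ℂ) • u s)) volume p q :=
    ContinuousOn.intervalIntegrable_of_Icc hpq (by fun_prop)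
  have i2 : IntervalIntegrable (fun s => Complex.exp (-z * s) • ((χ s : ℂ) • g s)) volume p q :=
    ContinuousOn.intervalIntegrable_of_Icc hpq (by fun_prop)
  have i1' : IntervalIntegrable (fun s => K (Complex.exp (-z * s) • ((ψ s : ℂ) • u s)))
      volume p q :=
    ContinuousOn.intervalIntegrable_of_Icc hpq (by fun_prop)
  have hftc := intervalIntegral.integral_eq_sub_of_hasDeriv_right_of_le hpq
    (f := fun s => Complex.exp (-z * s) • (χ s : ℂ) • K (u s))
    (f' := fun s => K (Complex.exp (-z * s) • ((ψ s : ℂ) • u s)) -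
      Complex.exp (-z * s) • ((χ s : ℂ) • g s)) (by fun_prop) (fun s hs => ?_) (i1'.sub i2)
  · rw [intervalIntegral.integral_sub i1' i2, K.intervalIntegral_comp_comm i1] at hftc
    rw [← hftc]
    abel
  · have hs0 : 0 < s := hp.trans_lt hs.1
    have d1 : HasDerivAt (fun s : ℝ => Complex.exp (-z * s)) (Complex.exp (-z * s) * (-z * 1)) s :=
      ((Complex.ofRealCLM.hasDerivAt (x := s)).const_mul (-z)).cexp
    have d2 := (hχψ s hs).ofReal_comp
    have d3 := (hderiv s hs0.le).hasDerivAt (Ici_mem_nhds hs0)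
    have d := (d1.smul (d2.smul d3)).hasDerivWithinAt (s := Ioi s)
    refine d.congr_deriv ?_
    simp only [map_smul, Pi.smul_apply', smul_sub, smul_add, smul_smul]
    module

/-- The resolvent estimate turns into a weighted `L²` estimate by Plancherel's theorem. -/
theorem weighted_energy_le {ω r a p q : ℝ} {K : ℂ → H →L[ℂ] H} {u g : ℝ → H} {ψ : ℝ → ℝ}
    (hr : 0 < r) (ha : 0 ≤ a) (hap : a ≤ p) (hpq : p ≤ q)
    (hu : ContinuousOn u (Ici 0)) (hg : ContinuousOn g (Ici 0)) (hψ : ContinuousOn ψ (Ici 0))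
    (hK : ∀ z : ℂ, ω ≤ z.re → ‖K z‖ ≤ 1 / r)
    (hderiv : ∀ z : ℂ, ω ≤ z.re → ∀ s, 0 ≤ s →
      HasDerivWithinAt (fun s => K z (u s)) (z • K z (u s) - g s) (Ici 0) s)
    (hhol : ∀ s, 0 ≤ s → DifferentiableOn ℂ (fun z => K z (u s)) {z | ω ≤ z.re})
    (hdecay : ∀ s, 0 ≤ s → ∃ M, ∀ z : ℂ, ω ≤ z.re → ‖z‖ * ‖K z (u s)‖ ≤ M) :
    (∫ s in 0..a, ψ s) ^ 2 * ∫ s in p..q, Real.exp (-2 * ω * s) * ‖g s‖ ^ 2 ≤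
      (1 / r) ^ 2 * ∫ s in 0..a, Real.exp (-2 * ω * s) * ‖(ψ s : ℂ) • u s‖ ^ 2 := by
  set N := ∫ s in 0..a, ψ s with hN
  set X := ∫ s in p..q, Real.exp (-2 * ω * s) * ‖g s‖ ^ 2 with hX
  set Y := ∫ s in 0..a, Real.exp (-2 * ω * s) * ‖(ψ s : ℂ) • u s‖ ^ 2 with hY
  set L := q + 1 with hL
  have haL : a ≤ L := by linarith
  have hL0 : 0 ≤ L := ha.trans haL
  set χ₀ : ℝ → ℝ := fun s => ∫ σ in 0..s, ψ σ with hχ₀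
  set χ : ℝ → ℝ := fun s => χ₀ (min s a) with hχ
  have hψi : ∀ s, 0 ≤ s → IntervalIntegrable ψ volume 0 s := fun s hs =>
    ContinuousOn.intervalIntegrable_of_Icc hs (hψ.mono fun x hx => hx.1)
  have hχ₀c : ContinuousOn χ₀ (Icc 0 a) := by
    have := intervalIntegral.continuousOn_primitive_interval (f := ψ) (a := 0) (b := a)
      ((intervalIntegrable_iff_integrableOn_Icc_of_le ha).1 (hψi a ha) |>.mono_set (by
        rw [uIcc_of_le ha]))
    rwa [uIcc_of_le ha] at this
  have hχ₀d : ∀ s ∈ Ioo 0 a, HasDerivAt χ₀ (ψ s) s := fun s hs =>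
    intervalIntegral.integral_hasDerivAt_right (hψi s hs.1.le)
      (hψ.stronglyMeasurableAtFilter_nhdsWithin measurableSet_Ici s |>.filter_mono
        (by rw [nhdsWithin_eq_nhds.2 (Ici_mem_nhds hs.1)]))
      (hψ.continuousAt (Ici_mem_nhds hs.1))
  have hχc : ContinuousOn χ (Icc 0 L) :=
    hχ₀c.comp (by fun_prop) fun s hs => ⟨le_min hs.1 ha, min_le_right _ _⟩
  have hcF : ContinuousOn (fun s : ℝ => Complex.exp (-ω * s) • ((ψ s : ℂ) • u s)) (Icc 0 a) := by
    have h1 : ContinuousOn (fun s => (ψ s : ℂ)) (Icc 0 a) :=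
      Complex.continuous_ofReal.comp_continuousOn (hψ.mono fun s hs => hs.1)
    have h2 : ContinuousOn u (Icc 0 a) := hu.mono fun s hs => hs.1
    fun_prop
  have hcG : ContinuousOn (fun s : ℝ => Complex.exp (-ω * s) • ((χ s : ℂ) • g s)) (Icc 0 L) := by
    have h1 : ContinuousOn (fun s => (χ s : ℂ)) (Icc 0 L) :=
      Complex.continuous_ofReal.comp_continuousOn hχc
    have h2 : ContinuousOn g (Icc 0 L) := hg.mono fun s hs => hs.1
    fun_prop
  have hch : ContinuousOn (fun s : ℝ => Complex.exp (-ω * s) • g s) (Icc p q) := by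
    have h2 : ContinuousOn g (Icc p q) := hg.mono fun s hs => (ha.trans hap).trans hs.1
    fun_prop
  set F := (Ioc 0 a).indicator fun s : ℝ => Complex.exp (-ω * s) • ((ψ s : ℂ) • u s) with hF
  set G := (Ioc 0 L).indicator fun s : ℝ => Complex.exp (-ω * s) • ((χ s : ℂ) • g s) with hG
  set h := (Ioc p q).indicator fun s : ℝ => Complex.exp (-ω * s) • g s with hh
  have iF : Integrable F := integrable_indicator_Ioc hcF
  have iG : Integrable G := integrable_indicator_Ioc hcG
  have ih : Integrable h := integrable_indicator_Ioc hch
  have mF : MemLp F 2 := memLp_indicator_Ioc hcF 2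
  have mG : MemLp G 2 := memLp_indicator_Ioc hcG 2
  have mh : MemLp h 2 := memLp_indicator_Ioc hch 2
  have nF : ∫ ξ, ‖𝓕 F ξ‖ ^ 2 = Y := by
    rw [integral_norm_sq_fourier iF mF, hF, integral_norm_sq_indicator_Ioc ha]
  have nh' : ∫ s, ‖h s‖ ^ 2 = X := integral_norm_sq_indicator_Ioc hpq g
  have nh : ∫ ξ, ‖𝓕 h ξ‖ ^ 2 = X := by
    rw [integral_norm_sq_fourier ih mh, nh']
  let z : ℝ → ℂ := fun ν => ω + (2 * Real.pi * ν : ℝ) * Complex.I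
  have hz : ∀ ν, ω ≤ (z ν).re := fun ν => by simp [z]
  have hχa : ∀ s, a ≤ s → χ s = N := fun s hs => by simp [hχ, min_eq_right hs, hχ₀, hN]
  set e : ℝ → H := fun ν => Complex.exp (-(z ν) * L) • ((N : ℂ) • K (z ν) (u L)) with he
  have hGF : ∀ ν, 𝓕 G ν = K (z ν) (𝓕 F ν) - e ν := by
    intro ν
    rw [hG, hF, fourier_indicator_Ioc hL0, fourier_indicator_Ioc ha]
    have hGc : ContinuousOn (fun s : ℝ => Complex.exp (-(z ν) * s) • ((χ s : ℂ) • g s))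
        (Icc 0 L) := by
      have h1 : ContinuousOn (fun s => (χ s : ℂ)) (Icc 0 L) :=
        Complex.continuous_ofReal.comp_continuousOn hχc
      have h2 : ContinuousOn g (Icc 0 L) := hg.mono fun s hs => hs.1
      fun_prop
    rw [← intervalIntegral.integral_add_adjacent_intervals (b := a)
      (ContinuousOn.intervalIntegrable_of_Icc ha (hGc.mono (Icc_subset_Icc_right haL)))
      (ContinuousOn.intervalIntegrable_of_Icc haL (hGc.mono (Icc_subset_Icc_left ha)))]
    rw [integral_duhamel (K := K (z ν)) le_rfl ha hu hg (hderiv _ (hz ν))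
        (hχc.mono (Icc_subset_Icc_right haL)) (hψ.mono fun s hs => hs.1) fun s hs =>
          (hχ₀d s hs).congr_of_eventuallyEq (by
            filter_upwards [Iio_mem_nhds hs.2] with y hy
            simp [hχ, min_eq_left (mem_Iio.1 hy).le]),
      integral_duhamel (K := K (z ν)) (ψ := fun _ => 0) ha haL hu hg (hderiv _ (hz ν))
        (hχc.mono (Icc_subset_Icc_left ha)) continuousOn_const fun s hs =>
          (hasDerivAt_const s N).congr_of_eventuallyEq (by
            filter_upwards [Ioi_mem_nhds hs.1] with y hy using hχa y (mem_Ioi.1 hy).le)]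
    have hχ0 : χ 0 = 0 := by simp [hχ, min_eq_left ha, hχ₀]
    simp [hχ0, hχa a le_rfl, hχa L haL, he, z]
  obtain ⟨M, hM⟩ := hdecay L hL0
  have hN0 : 0 ≤ ‖(N : ℂ)‖ := norm_nonneg _
  have hMN : ∀ w : ℂ, ω ≤ w.re → ‖w‖ * ‖(N : ℂ) • K w (u L)‖ ≤ ‖(N : ℂ)‖ * M := fun w hw => by
    rw [norm_smul, mul_left_comm]
    exact mul_le_mul_of_nonneg_left (hM w hw) hN0
  have hBN : ∀ w : ℂ, ω ≤ w.re → ‖(N : ℂ) • K w (u L)‖ ≤ ‖(N : ℂ)‖ * (1 / r * ‖u L‖) :=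
    fun w hw => by
      rw [norm_smul]
      gcongr
      exact (K w).le_of_opNorm_le (hK w hw) _
  have hkd : DifferentiableOn ℂ (fun w => (N : ℂ) • K w (u L)) {w | ω ≤ w.re} :=
    (hhol L hL0).const_smul _
  have ce : Continuous e := by
    refine Continuous.smul (by fun_prop) ?_
    exact hkd.continuousOn.comp_continuous (by fun_prop) hz
  have hKF : ∀ ν, K (z ν) (𝓕 F ν) = 𝓕 G ν + e ν := fun ν => by rw [hGF]; abel
  have cKF : Continuous fun ν => K (z ν) (𝓕 F ν) := by
    simp_rw [hKF]
    exact (continuous_fourier_of_integrable iG).add ce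
  have mFF := memLp_two_fourier iF mF
  have bKF : ∀ ν, ‖K (z ν) (𝓕 F ν)‖ ≤ 1 / r * ‖𝓕 F ν‖ := fun ν =>
    (K (z ν)).le_of_opNorm_le (hK _ (hz ν)) _
  have mKF : MemLp (fun ν => K (z ν) (𝓕 F ν)) 2 :=
    mFF.of_le_mul cKF.aestronglyMeasurable (.of_forall bKF)
  have mFh := memLp_two_fourier ih mh
  have me : MemLp e 2 := by
    have : e = (fun ν => K (z ν) (𝓕 F ν)) - 𝓕 G := by
      ext ν
      simp [hGF]
    rw [this]
    exact mKF.sub (memLp_two_fourier iG mG)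
  have horth : ∫ ν, inner ℂ (𝓕 h ν) (e ν) = 0 :=
    integral_inner_fourier_eq_zero (by linarith) hch hkd hBN hMN me
  have hpair : ∫ s, inner ℂ (h s) (G s) = ((N * X : ℝ) : ℂ) := by
    rw [← nh', ← integral_const_mul, ← integral_complex_ofReal]
    congr 1 with s
    by_cases hs : s ∈ Ioc p q
    · have hs' : s ∈ Ioc 0 L := ⟨(ha.trans hap).trans_lt hs.1, hs.2.trans (by linarith)⟩
      rw [hG, hh, indicator_of_mem hs, indicator_of_mem hs', hχa s (hap.trans hs.1.le),
        smul_comm, inner_smul_right, inner_self_eq_norm_sq_to_K]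
      simp
    · simp [hh, indicator_of_notMem hs]
  have hplan := integral_inner_fourier ih mh iG mG
  have hsplit : ∫ ν, inner ℂ (𝓕 h ν) (𝓕 G ν) = ∫ ν, inner ℂ (𝓕 h ν) (K (z ν) (𝓕 F ν)) := by
    simp_rw [hGF, inner_sub_right]
    rw [integral_sub (integrable_inner_of_memLp_two mFh mKF)
      (integrable_inner_of_memLp_two mFh me), horth, sub_zero]
  have hY0 : 0 ≤ Y := nF ▸ integral_nonneg fun _ => by positivity
  have hX0 : 0 ≤ X := nh' ▸ integral_nonneg fun _ => by positivity
  have nKF : ∫ ν, ‖K (z ν) (𝓕 F ν)‖ ^ 2 ≤ (1 / r) ^ 2 * Y := by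
    rw [← nF, ← integral_const_mul]
    refine integral_mono_of_nonneg (.of_forall fun _ => by positivity)
      (((memLp_two_iff_integrable_sq_norm mFF.1).1 mFF).const_mul _) (.of_forall fun ν => ?_)
    simp only [← mul_pow]
    gcongr
    exact bKF ν
  have hcs := norm_integral_inner_le mFh mKF
  rw [← hsplit, hplan, hpair, nh, Complex.norm_real, Real.norm_eq_abs] at hcs
  have hfin : (N * X) ^ 2 ≤ X * ((1 / r) ^ 2 * Y) := by
    calc (N * X) ^ 2 = |N * X| ^ 2 := (sq_abs _).symm
      _ ≤ (√X * √(∫ ν, ‖K (z ν) (𝓕 F ν)‖ ^ 2)) ^ 2 := by gcongr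
      _ = X * ∫ ν, ‖K (z ν) (𝓕 F ν)‖ ^ 2 := by
        rw [mul_pow, Real.sq_sqrt hX0, Real.sq_sqrt (integral_nonneg fun _ => by positivity)]
      _ ≤ _ := by gcongr
  rcases hX0.eq_or_lt with h0 | h0
  · rw [← h0, mul_zero]
    positivity
  · refine le_of_mul_le_mul_left ?_ h0
    linarith

end Energy

section Resolvent

variable {H : Type*} [NormedAddCommGroup H] [InnerProductSpace ℂ H]
  {D : Submodule ℂ H} {A C : D →ₗ[ℂ] H} {ω r : ℝ}

theorem exists_comp_resolvent
    (hres : ∀ z : ℂ, ω ≤ z.re → Function.Bijective (fun x : D => z • (x : H) - A x) ∧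
      ∀ x : D, ‖C x‖ ≤ 1 / r * ‖z • (x : H) - A x‖) (hr : 0 < r) :
    ∃ K : ℂ → H →L[ℂ] H, ∀ z : ℂ, ω ≤ z.re →
      ‖K z‖ ≤ 1 / r ∧ ∀ x : D, K z (z • (x : H) - A x) = C x := by
  suffices ∀ z : ℂ, ∃ K : H →L[ℂ] H, ω ≤ z.re →
      ‖K‖ ≤ 1 / r ∧ ∀ x : D, K (z • (x : H) - A x) = C x from ⟨_, fun z => (this z).choose_spec⟩
  intro z
  by_cases hz : ω ≤ z.re
  · let e : D ≃ₗ[ℂ] H := LinearEquiv.ofBijective (z • D.subtype - A) (hres z hz).1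
    have he : ∀ x : D, e x = z • (x : H) - A x := fun _ => rfl
    refine ⟨(C ∘ₗ e.symm.toLinearMap).mkContinuous (1 / r) fun v => ?_, fun _ =>
      ⟨LinearMap.mkContinuous_norm_le _ (by positivity) _, fun x => ?_⟩⟩
    · simpa [← he] using (hres z hz).2 (e.symm v)
    · simp [← he]
  · exact ⟨0, fun h => absurd h hz⟩

variable {K : ℂ → H →L[ℂ] H}

theorem comp_resolvent_sub
    (hK : ∀ z : ℂ, ω ≤ z.re → ∀ x : D, K z (z • (x : H) - A x) = C x)
    {w z : ℂ} (hw : ω ≤ w.re) (hz : ω ≤ z.re) (x : D) :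
    K w (z • (x : H) - A x) - K z (z • (x : H) - A x) = -((w - z) • K w x) := by
  have : z • (x : H) - A x = (w • (x : H) - A x) - (w - z) • (x : H) := by module
  rw [hK z hz, this, map_sub, hK w hw, map_smul]
  abel

theorem continuousOn_comp_resolvent
    (hres : ∀ z : ℂ, ω ≤ z.re → Function.Surjective (fun x : D => z • (x : H) - A x))
    (hKr : ∀ z : ℂ, ω ≤ z.re → ‖K z‖ ≤ r)
    (hK : ∀ z : ℂ, ω ≤ z.re → ∀ x : D, K z (z • (x : H) - A x) = C x) (v : H) :
    ContinuousOn (fun z => K z v) {z | ω ≤ z.re} := by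
  intro z hz
  obtain ⟨x, rfl⟩ := hres z hz v
  rw [ContinuousWithinAt, tendsto_iff_norm_sub_tendsto_zero]
  have hlim : Tendsto (fun w : ℂ => ‖w - z‖ * (r * ‖(x : H)‖)) (𝓝[{z | ω ≤ z.re}] z) (𝓝 0) := by
    have : Continuous fun w : ℂ => ‖w - z‖ * (r * ‖(x : H)‖) := by fun_prop
    simpa using (this.tendsto z).mono_left nhdsWithin_le_nhds
  refine squeeze_zero' (.of_forall fun _ => norm_nonneg _) ?_ hlim
  filter_upwards [self_mem_nhdsWithin] with w hw
  rw [comp_resolvent_sub hK hw hz, norm_neg, norm_smul]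
  gcongr
  exact (K w).le_of_opNorm_le (hKr w hw) _

theorem differentiableOn_comp_resolvent
    (hres : ∀ z : ℂ, ω ≤ z.re → Function.Surjective (fun x : D => z • (x : H) - A x))
    (hKr : ∀ z : ℂ, ω ≤ z.re → ‖K z‖ ≤ r)
    (hK : ∀ z : ℂ, ω ≤ z.re → ∀ x : D, K z (z • (x : H) - A x) = C x) (v : H) :
    DifferentiableOn ℂ (fun z => K z v) {z | ω ≤ z.re} := by
  intro z hz
  obtain ⟨x, rfl⟩ := hres z hz v
  refine HasDerivWithinAt.differentiableWithinAt (f' := -K z x) ?_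
  rw [hasDerivWithinAt_iff_tendsto_slope]
  refine Tendsto.congr' ?_ (((continuousOn_comp_resolvent hres hKr hK (x : H)) z hz).neg.mono_left
    (nhdsWithin_mono _ sdiff_subset))
  filter_upwards [self_mem_nhdsWithin] with w hw
  rw [slope_def_module, comp_resolvent_sub hK hw.1 hz, smul_neg, smul_smul,
    inv_mul_cancel₀ (sub_ne_zero.2 hw.2), one_smul, Pi.neg_apply]

theorem norm_mul_norm_comp_resolvent_le
    (hKr : ∀ z : ℂ, ω ≤ z.re → ‖K z‖ ≤ r)
    (hK : ∀ z : ℂ, ω ≤ z.re → ∀ x : D, K z (z • (x : H) - A x) = C x) {z : ℂ} (hz : ω ≤ z.re)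
    (x : D) : ‖z‖ * ‖K z x‖ ≤ ‖C x‖ + r * ‖A x‖ := by
  have : z • K z x = C x + K z (A x) := by
    rw [← hK z hz x, map_sub, map_smul]
    abel
  rw [← norm_smul, this]
  exact (norm_add_le _ _).trans (by gcongr; exact (K z).le_of_opNorm_le (hKr z hz) _)

end Resolvent

section Semigroup

variable {H : Type*} [NormedAddCommGroup H] [InnerProductSpace ℂ H]

/-- Averaging `S t y = S σ (S (t - σ) y)` over `0 ≤ σ ≤ b`. -/
theorem IsC0Semigroup.norm_sq_mul_integral_le {S : ℝ → H →L[ℂ] H} (hS : IsC0Semigroup S)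
    {m : ℝ → ℝ} (hm_cont : ContinuousOn m (Ici 0)) (hm_pos : ∀ t, 0 ≤ t → 0 < m t)
    (hm_bound : ∀ t, 0 ≤ t → ‖S t‖ ≤ m t) (ω : ℝ) {b t : ℝ} (hb : 0 ≤ b) (hbt : b ≤ t) (y : H) :
    ‖S t y‖ ^ 2 * ∫ s in 0..b, Real.exp (2 * ω * s) / m s ^ 2 ≤
      Real.exp (ω * t) ^ 2 * ∫ s in t - b..t, Real.exp (-2 * ω * s) * ‖S s y‖ ^ 2 := by
  have hm : ContinuousOn m (Icc 0 b) := hm_cont.mono fun s hs => hs.1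
  have hm0 : ∀ s ∈ Icc 0 b, m s ^ 2 ≠ 0 := fun s hs => (pow_pos (hm_pos s hs.1) 2).ne'
  have hSc : ContinuousOn (fun s => S (t - s) y) (Icc 0 b) :=
    (hS.cont y).comp (by fun_prop) fun s hs => sub_nonneg.2 (hs.2.trans hbt)
  have hsubst := intervalIntegral.integral_comp_sub_left
    (fun s => Real.exp (ω * t) ^ 2 * (Real.exp (-2 * ω * s) * ‖S s y‖ ^ 2)) t (a := 0) (b := b)
  rw [sub_zero] at hsubst
  rw [← intervalIntegral.integral_const_mul, ← intervalIntegral.integral_const_mul, ← hsubst]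
  refine intervalIntegral.integral_mono_on hb
    (ContinuousOn.intervalIntegrable_of_Icc hb (by fun_prop (disch := assumption)))
    (ContinuousOn.intervalIntegrable_of_Icc hb (continuousOn_const.mul
      (ContinuousOn.mul (by fun_prop) (hSc.norm.pow 2)))) fun s hs => ?_
  have hms := hm_pos s hs.1
  have hst : 0 ≤ t - s := sub_nonneg.2 (hs.2.trans hbt)
  have h1 : ‖S t y‖ ≤ m s * ‖S (t - s) y‖ := by
    have h2 : S t y = S s (S (t - s) y) := by
      rw [← ContinuousLinearMap.comp_apply, ← hS.map_add s hs.1 _ hst, add_sub_cancel]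
    rw [h2]
    exact (S s).le_of_opNorm_le (hm_bound s hs.1) _
  have h3 : Real.exp (ω * t) ^ 2 * Real.exp (-2 * ω * (t - s)) = Real.exp (2 * ω * s) := by
    rw [← Real.exp_nat_mul, ← Real.exp_add]
    congr 1
    push_cast
    ring
  rw [← mul_assoc, h3, mul_div_assoc', div_le_iff₀ (by positivity)]
  calc ‖S t y‖ ^ 2 * Real.exp (2 * ω * s)
      ≤ (m s * ‖S (t - s) y‖) ^ 2 * Real.exp (2 * ω * s) := by gcongr
    _ = _ := by ring

theorem IsC0Semigroup.integral_weight_mul_norm_sq_le {S : ℝ → H →L[ℂ] H} (hS : IsC0Semigroup S)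
    {m : ℝ → ℝ} (hm_cont : ContinuousOn m (Ici 0)) (hm_pos : ∀ t, 0 ≤ t → 0 < m t)
    (hm_bound : ∀ t, 0 ≤ t → ‖S t‖ ≤ m t) (ω : ℝ) {a : ℝ} (ha : 0 ≤ a) (x : H) :
    ∫ s in 0..a, Real.exp (-2 * ω * s) *
        ‖((Real.exp (2 * ω * s) / m s ^ 2 : ℝ) : ℂ) • S s x‖ ^ 2 ≤
      (∫ s in 0..a, Real.exp (2 * ω * s) / m s ^ 2) * ‖x‖ ^ 2 := by
  have hm : ContinuousOn m (Icc 0 a) := hm_cont.mono fun s hs => hs.1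
  have hm0 : ∀ s ∈ Icc 0 a, m s ^ 2 ≠ 0 := fun s hs => (pow_pos (hm_pos s hs.1) 2).ne'
  have hSc : ContinuousOn (fun s => S s x) (Icc 0 a) := (hS.cont x).mono fun s hs => hs.1
  have hψ : ContinuousOn (fun s => Real.exp (2 * ω * s) / m s ^ 2) (Icc 0 a) := by
    fun_prop (disch := assumption)
  have hψ' : ContinuousOn (fun s => ((Real.exp (2 * ω * s) / m s ^ 2 : ℝ) : ℂ)) (Icc 0 a) :=
    Complex.continuous_ofReal.comp_continuousOn hψ
  rw [← intervalIntegral.integral_mul_const]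
  refine intervalIntegral.integral_mono_on ha
    (ContinuousOn.intervalIntegrable_of_Icc ha (by fun_prop))
    (ContinuousOn.intervalIntegrable_of_Icc ha (by fun_prop)) fun s hs => ?_
  have hms := hm_pos s hs.1
  have h1 : ‖S s x‖ ≤ m s * ‖x‖ := (S s).le_of_opNorm_le (hm_bound s hs.1) _
  rw [norm_smul, Complex.norm_real, Real.norm_of_nonneg (by positivity)]
  have h3 : Real.exp (-2 * ω * s) * Real.exp (2 * ω * s) = 1 := by
    rw [← Real.exp_add]
    simp
  calc Real.exp (-2 * ω * s) * (Real.exp (2 * ω * s) / m s ^ 2 * ‖S s x‖) ^ 2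
      ≤ Real.exp (-2 * ω * s) * (Real.exp (2 * ω * s) / m s ^ 2 * (m s * ‖x‖)) ^ 2 := by gcongr
    _ = (Real.exp (-2 * ω * s) * Real.exp (2 * ω * s)) *
        (Real.exp (2 * ω * s) / m s ^ 2 * ‖x‖ ^ 2) := by field_simp
    _ = _ := by rw [h3, one_mul]

variable [CompleteSpace H]

theorem IsGenerator.integral_mul_integral_le {S : ℝ → H →L[ℂ] H} {D : Submodule ℂ H}
    {A C : D →ₗ[ℂ] H} (hS : IsC0Semigroup S) (hA : IsGenerator S D A)
    {m : ℝ → ℝ} (hm_cont : ContinuousOn m (Ici 0)) (hm_pos : ∀ t, 0 ≤ t → 0 < m t)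
    (hm_bound : ∀ t, 0 ≤ t → ‖S t‖ ≤ m t)
    (hC : ∀ (x : D) (t : ℝ) (ht : 0 ≤ t), C ⟨S t (x : H), hA.mem x t ht⟩ = S t (C x))
    {ω r : ℝ} (hr : 0 < r)
    (hres : ∀ z : ℂ, ω ≤ z.re →
      Function.Bijective (fun x : D => z • (x : H) - A x) ∧
      ∀ x : D, ‖C x‖ ≤ (1 / r) * ‖z • (x : H) - A x‖)
    {a p q : ℝ} (ha : 0 < a) (hap : a ≤ p) (hpq : p ≤ q) (x : D) :
    (∫ s in 0..a, Real.exp (2 * ω * s) / m s ^ 2) *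
        ∫ s in p..q, Real.exp (-2 * ω * s) * ‖S s (C x)‖ ^ 2 ≤ (1 / r) ^ 2 * ‖(x : H)‖ ^ 2 := by
  obtain ⟨K, hKall⟩ := exists_comp_resolvent hres hr
  have hKr := fun z hz => (hKall z hz).1
  have hK := fun z hz => (hKall z hz).2
  have hsurj := fun z hz => (hres z hz).1.2
  have hψ : ContinuousOn (fun s => Real.exp (2 * ω * s) / m s ^ 2) (Ici 0) := by
    have hm0 : ∀ s ∈ Ici (0 : ℝ), m s ^ 2 ≠ 0 := fun s hs => (pow_pos (hm_pos s hs) 2).ne'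
    fun_prop (disch := assumption)
  have hmain := weighted_energy_le (u := fun s => S s x) (g := fun s => S s (C x)) (K := K)
    hr ha.le hap hpq (hS.cont x) (hS.cont (C x)) hψ hKr
    (fun z hz s hs => by
      have h1 := ((K z).restrictScalars ℝ).hasFDerivAt.comp_hasDerivWithinAt s (hA.hasDeriv x s hs)
      refine h1.congr_deriv ?_
      rw [← hC x s hs, ← hK z hz]
      simp)
    (fun s _ => differentiableOn_comp_resolvent hsurj hKr hK (S s x))
    (fun s hs => ⟨_, fun z hz =>
      norm_mul_norm_comp_resolvent_le hKr hK hz ⟨S s x, hA.mem x s hs⟩⟩)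
  have hN : 0 < ∫ s in 0..a, Real.exp (2 * ω * s) / m s ^ 2 :=
    intervalIntegral.intervalIntegral_pos_of_pos_on
      (ContinuousOn.intervalIntegrable_of_Icc ha.le (hψ.mono fun s hs => hs.1))
      (fun s hs => div_pos (Real.exp_pos _) (pow_pos (hm_pos s hs.1.le) 2)) ha
  have hY := hS.integral_weight_mul_norm_sq_le hm_cont hm_pos hm_bound ω ha.le (x : H)
  have hY' := mul_le_mul_of_nonneg_left hY (sq_nonneg (1 / r))
  refine le_of_mul_le_mul_left ?_ hN
  linarith

end Semigroup

theorem statement1 {H : Type*} [NormedAddCommGroup H] [InnerProductSpace ℂ H] [CompleteSpace H]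
    (S : ℝ → H →L[ℂ] H) (D : Submodule ℂ H) (A : D →ₗ[ℂ] H)
    (hS : IsC0Semigroup S) (hA : IsGenerator S D A)
    (m : ℝ → ℝ) (hm_cont : ContinuousOn m (Ici 0)) (hm_pos : ∀ t, 0 ≤ t → 0 < m t)
    (hm_bound : ∀ t, 0 ≤ t → ‖S t‖ ≤ m t)
    (C : D →ₗ[ℂ] H)
    (hC : ∀ (x : D) (t : ℝ) (ht : 0 ≤ t), C ⟨S t (x : H), hA.mem x t ht⟩ = S t (C x))
    (ω rC : ℝ) (hrC : 0 < rC)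
    (hres : ∀ z : ℂ, ω ≤ z.re →
      Function.Bijective (fun x : D => z • (x : H) - A x) ∧
      ∀ x : D, ‖C x‖ ≤ (1 / rC) * ‖z • (x : H) - A x‖) :
    ∀ (a : ℝ) (ha : 0 < a) (b : ℝ) (hb : 0 < b) (t : ℝ) (ht : a + b ≤ t),
      ∃ T : H →L[ℂ] H,
        (∀ x : D, T (x : H) = C ⟨S t (x : H), hA.mem x t (by linarith)⟩) ∧
        ‖T‖ ≤ Real.exp (ω * t) /
          (rC * Real.sqrt (∫ s in (0:ℝ)..a, Real.exp (2 * ω * s) / m s ^ 2)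
              * Real.sqrt (∫ s in (0:ℝ)..b, Real.exp (2 * ω * s) / m s ^ 2)) := by
  intro a ha b hb t ht
  set Na := ∫ s in (0:ℝ)..a, Real.exp (2 * ω * s) / m s ^ 2 with hNa
  set Nb := ∫ s in (0:ℝ)..b, Real.exp (2 * ω * s) / m s ^ 2 with hNb
  have hpos : ∀ c : ℝ, 0 < c → 0 < ∫ s in (0:ℝ)..c, Real.exp (2 * ω * s) / m s ^ 2 := by
    intro c hc
    refine intervalIntegral.intervalIntegral_pos_of_pos_on
      (ContinuousOn.intervalIntegrable_of_Icc hc.le ?_)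
      (fun s hs => div_pos (Real.exp_pos _) (pow_pos (hm_pos s hs.1.le) 2)) hc
    have hm : ContinuousOn m (Icc 0 c) := hm_cont.mono fun s hs => hs.1
    have hm0 : ∀ s ∈ Icc 0 c, m s ^ 2 ≠ 0 := fun s hs => (pow_pos (hm_pos s hs.1) 2).ne'
    fun_prop (disch := assumption)
  have hNa0 : 0 < Na := hpos a ha
  have hNb0 : 0 < Nb := hpos b hb
  have hbound : ∀ x : D, ‖S t (C x)‖ ≤ Real.exp (ω * t) / (rC * √Na * √Nb) * ‖(x : H)‖ := by
    intro x
    have h1 := hS.norm_sq_mul_integral_le hm_cont hm_pos hm_bound ω hb.le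
      (show b ≤ t by linarith) (C x)
    have h2 := IsGenerator.integral_mul_integral_le hS hA hm_cont hm_pos hm_bound hC hrC hres ha
      (show a ≤ t - b by linarith) (show t - b ≤ t by linarith) x
    rw [← hNb] at h1
    rw [← hNa] at h2
    refine le_of_sq_le_sq ?_ (by positivity)
    rw [mul_pow, div_pow, mul_pow, mul_pow, Real.sq_sqrt hNa0.le, Real.sq_sqrt hNb0.le,
      div_mul_eq_mul_div, le_div_iff₀ (by positivity)]
    have h3 := mul_le_mul_of_nonneg_left h1 (by positivity : 0 ≤ rC ^ 2 * Na)
    have h4 := mul_le_mul_of_nonneg_left h2 (by positivity : 0 ≤ rC ^ 2 * Real.exp (ω * t) ^ 2)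
    have h5 : rC ^ 2 * Real.exp (ω * t) ^ 2 * ((1 / rC) ^ 2 * ‖(x : H)‖ ^ 2) =
        Real.exp (ω * t) ^ 2 * ‖(x : H)‖ ^ 2 := by field_simp
    linarith
  let T₀ : D →L[ℂ] H := ((S t).toLinearMap ∘ₗ C).mkContinuous _ hbound
  have hdense : DenseRange D.subtypeL := by simpa [DenseRange] using hA.dense
  refine ⟨T₀.extend D.subtypeL, fun x => ?_, ?_⟩
  · rw [hC x t (by linarith)]
    exact T₀.extend_eq hdense isometry_subtype_coe.isUniformInducing x
  · refine (T₀.opNorm_extend_le hdense (N := 1) fun x => by simp).trans ?_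
    rw [NNReal.coe_one, one_mul]
    exact LinearMap.mkContinuous_norm_le _ (by positivity) _
end

section
/- Let S(t) be a strongly continuous one-parameter semigroup on a complex Hilbert space H with generator A. Let m : [0,∞) → (0,∞) be a positive continuously differentiable function with ‖S(t)‖ ≤ m(t) for all t ≥ 0. Let ω ∈ ℝ and r > 0 be such that the resolvent bound R(ω, r) holds. Define μ(t) = (1/r)(m′(t)/m(t) − ω) and let φ : [0, a*] → ℝ solve φ′(t) = r(φ(t)² + 2 μ(t) φ(t) + 1) with φ(0) = 0, where a* ∈ (0,∞) is such that φ(a*) = 1 and φ(s) < 1 for 0 ≤ s < a* (i.e. a* is the first time φ reaches 1). Then for every t ≥ 2a*, ‖S(t)‖ ≤ e^{(ω − r)(t − 2a*)} m(a*)². -/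
open Set MeasureTheory

open scoped FourierTransform SchwartzMap Topology

theorem integrable_continuous_fourier {H : Type*} [NormedAddCommGroup H] [InnerProductSpace ℂ H]
    {f : ℝ → H} (hf : Integrable f) : Continuous (𝓕 f) :=
  VectorFourier.fourierIntegral_continuous Real.continuous_fourierChar
    (by exact (innerSL ℝ (E := ℝ)).continuous₂) hf

open scoped ContDiff in
theorem Lp_fourier_ae_eq {H : Type*} [NormedAddCommGroup H] [InnerProductSpace ℂ H]
    [CompleteSpace H] {f : ℝ → H} (hf : Integrable f) (hf2 : MemLp f 2) :
    (𝓕 (hf2.toLp f) : Lp H 2 (volume : Measure ℝ)) =ᵐ[volume] 𝓕 f := by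
  apply ae_eq_of_integral_contDiff_smul_eq
  · exact (Lp.memLp _).locallyIntegrable (by norm_num)
  · exact (integrable_continuous_fourier hf).locallyIntegrable
  · intro g g_smooth g_cpt
    have hg₁ : HasCompactSupport (Complex.ofRealCLM ∘ g) := g_cpt.comp_left rfl
    have hg₂ : ContDiff ℝ ∞ (Complex.ofRealCLM ∘ g) := by fun_prop
    set G : 𝓢(ℝ, ℂ) := hg₁.toSchwartzMap hg₂ with hG
    have hGx : ∀ x, G x = (g x : ℂ) := fun x => by simp [hG]
    have h1 := congrArg (fun T => T G) (Lp.fourier_toTemperedDistribution_eq (hf2.toLp f))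
    simp only [TemperedDistribution.fourier_apply, Lp.toTemperedDistribution_apply, hGx] at h1
    have h2 : ∫ x, (𝓕 G) x • f x = ∫ x, G x • 𝓕 f x := by
      have := VectorFourier.integral_fourierIntegral_smul_eq_flip (L := innerₗ ℝ)
        (μ := volume) (ν := volume) Real.continuous_fourierChar continuous_inner
        G.integrable hf
      rw [flip_innerₗ] at this
      exact this
    have h3 : ∫ x, (𝓕 G) x • (hf2.toLp f) x = ∫ x, (𝓕 G) x • f x := by
      apply integral_congr_ae
      filter_upwards [hf2.coeFn_toLp] with x hx
      rw [hx]
    rw [h3, h2] at h1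
    simpa [hGx] using h1.symm

/-- Plancherel's theorem for functions in `L¹ ∩ L²`. -/
theorem eLpNorm_fourier_eq {H : Type*} [NormedAddCommGroup H] [InnerProductSpace ℂ H]
    [CompleteSpace H] {f : ℝ → H} (hf : Integrable f) (hf2 : MemLp f 2) :
    eLpNorm (𝓕 f) 2 volume = eLpNorm f 2 volume := by
  rw [← eLpNorm_congr_ae (Lp_fourier_ae_eq hf hf2), ← eLpNorm_congr_ae hf2.coeFn_toLp]
  have := Lp.norm_fourier_eq (hf2.toLp f)
  rwa [Lp.norm_def, Lp.norm_def,
    ENNReal.toReal_eq_toReal_iff' (Lp.memLp _).2.ne (Lp.memLp _).2.ne] at this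

open Filter

theorem integral_norm_sq_eq_eLpNorm_sq {X H : Type*} [MeasurableSpace X] {μ : Measure X}
    [NormedAddCommGroup H] {f : X → H} (hf : MemLp f 2 μ) :
    ∫ x, ‖f x‖ ^ 2 ∂μ = (eLpNorm f 2 μ).toReal ^ 2 := by
  have h0 : 0 ≤ ∫ x, ‖f x‖ ^ 2 ∂μ := integral_nonneg fun x => by positivity
  rw [hf.eLpNorm_eq_integral_rpow_norm (by norm_num) (by norm_num)]
  rw [ENNReal.toReal_ofReal (by positivity)]
  simp only [ENNReal.toReal_ofNat, Real.rpow_ofNat]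
  rw [← Real.rpow_natCast, ← Real.rpow_mul h0]
  norm_num

/-- If `r ‖𝓕 f‖ ≤ ‖𝓕 g‖` pointwise then the same inequality holds in the mean square for
`f` and `g`. -/
theorem sq_mul_integral_norm_sq_le_of_fourier {H : Type*} [NormedAddCommGroup H]
    [InnerProductSpace ℂ H] [CompleteSpace H] {f g : ℝ → H} (hf : Integrable f) (hf2 : MemLp f 2)
    (hg : Integrable g) (hg2 : MemLp g 2) {r : ℝ} (hr : 0 < r)
    (h : ∀ τ, r * ‖𝓕 f τ‖ ≤ ‖𝓕 g τ‖) :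
    r ^ 2 * ∫ t, ‖f t‖ ^ 2 ≤ ∫ t, ‖g t‖ ^ 2 := by
  have h1 : eLpNorm (r • 𝓕 f) 2 volume ≤ eLpNorm (𝓕 g) 2 volume :=
    eLpNorm_mono fun τ => by
      rw [Pi.smul_apply, norm_smul, Real.norm_of_nonneg hr.le]
      exact h τ
  rw [eLpNorm_const_smul, eLpNorm_fourier_eq hf hf2, eLpNorm_fourier_eq hg hg2] at h1
  rw [integral_norm_sq_eq_eLpNorm_sq hf2, integral_norm_sq_eq_eLpNorm_sq hg2, ← mul_pow]
  have h2 := ENNReal.toReal_mono hg2.2.ne h1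
  rw [ENNReal.toReal_mul, toReal_enorm, Real.norm_of_nonneg hr.le] at h2
  gcongr

theorem integrableOn_exp_smul_of_norm_le {H : Type*} [NormedAddCommGroup H] [NormedSpace ℂ H]
    {f : ℝ → H} (hf : AEStronglyMeasurable f (volume.restrict (Ioi 0))) {K ν : ℝ}
    (hfK : ∀ t, 0 ≤ t → ‖f t‖ ≤ K * Real.exp (ν * t)) {z : ℂ} (hz : ν < z.re) :
    IntegrableOn (fun t : ℝ => Complex.exp (-z * t) • f t) (Ioi 0) := by
  have h1 : IntegrableOn (fun t : ℝ => K * Real.exp (-(z.re - ν) * t)) (Ioi 0) :=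
    (exp_neg_integrableOn_Ioi 0 (sub_pos.2 hz)).const_mul K
  refine Integrable.mono' h1 ?_ ?_
  · exact (by fun_prop : Continuous fun t : ℝ => Complex.exp (-z * t)).aestronglyMeasurable.smul hf
  · filter_upwards [ae_restrict_mem measurableSet_Ioi] with t ht
    rw [norm_smul, Complex.norm_exp]
    calc _ ≤ Real.exp (-z * t : ℂ).re * (K * Real.exp (ν * t)) := by
          gcongr; exact hfK t (le_of_lt ht)
      _ = K * Real.exp (-(z.re - ν) * t) := by
          rw [mul_left_comm, ← Real.exp_add]
          simp
          ring_nf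
          simp

theorem memLp_two_exp_smul_of_norm_le {H : Type*} [NormedAddCommGroup H] [NormedSpace ℂ H]
    {f : ℝ → H} (hf : AEStronglyMeasurable f (volume.restrict (Ioi 0))) {K ν : ℝ}
    (hfK : ∀ t, 0 ≤ t → ‖f t‖ ≤ K * Real.exp (ν * t)) {z : ℂ} (hz : ν < z.re) :
    MemLp (fun t : ℝ => Complex.exp (-z * t) • f t) 2 (volume.restrict (Ioi 0)) := by
  have hm := (integrableOn_exp_smul_of_norm_le hf hfK hz).aestronglyMeasurable
  rw [memLp_two_iff_integrable_sq_norm hm]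
  have h1 : IntegrableOn (fun t : ℝ => K ^ 2 * Real.exp (-(2 * (z.re - ν)) * t)) (Ioi 0) :=
    (exp_neg_integrableOn_Ioi 0 (by linarith)).const_mul _
  refine Integrable.mono' h1 (hm.norm.pow 2) ?_
  · filter_upwards [ae_restrict_mem measurableSet_Ioi] with t ht
    rw [norm_smul, Complex.norm_exp, Real.norm_of_nonneg (by positivity)]
    calc _ ≤ (Real.exp (-z * t : ℂ).re * (K * Real.exp (ν * t))) ^ 2 := by
          gcongr; exact hfK t (le_of_lt ht)
      _ = K ^ 2 * Real.exp (-(2 * (z.re - ν)) * t) := by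
          rw [mul_left_comm, ← Real.exp_add, mul_pow, ← Real.exp_nat_mul]
          simp
          ring_nf
          simp

theorem ResolventBound.le_of_le {H : Type*} [NormedAddCommGroup H] [InnerProductSpace ℂ H]
    {D : Submodule ℂ H} {A : D →ₗ[ℂ] H} {ω r : ℝ} (h : ResolventBound D A ω r) {z : ℂ}
    (hz : ω ≤ z.re) (x : D) : r * ‖(x : H)‖ ≤ ‖z • (x : H) - A x‖ := by
  have hc : Continuous fun s : ℝ => ‖(z + s) • (x : H) - A x‖ := by fun_prop
  have ht := (hc.tendsto 0).mono_left (nhdsWithin_le_nhds (s := Ioi 0))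
  simp only [Complex.ofReal_zero, add_zero] at ht
  refine ge_of_tendsto ht ?_
  filter_upwards [self_mem_nhdsWithin] with s hs
  refine (h (z + s) ?_).2 x
  simp only [Complex.add_re, Complex.ofReal_re]
  linarith [mem_Ioi.1 hs]

/-- The resolvent at a point of the half-plane, as a bounded operator. -/
theorem ResolventBound.exists_resolvent {H : Type*} [NormedAddCommGroup H] [InnerProductSpace ℂ H]
    {D : Submodule ℂ H} {A : D →ₗ[ℂ] H} {ω r : ℝ} (hr : 0 < r) (h : ResolventBound D A ω r) {z : ℂ}
    (hz : ω < z.re) : ∃ R : H →L[ℂ] H, (∀ x : D, R (z • (x : H) - A x) = x) ∧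
      ∀ y, ∃ x : D, (x : H) = R y ∧ z • (x : H) - A x = y := by
  obtain ⟨hb, hl⟩ := h z hz
  let e : D ≃ₗ[ℂ] H := LinearEquiv.ofBijective (z • D.subtype - A) hb
  have he : ∀ x : D, e x = z • (x : H) - A x := fun x => rfl
  refine ⟨(D.subtype ∘ₗ e.symm.toLinearMap).mkContinuous r⁻¹ ?_, ?_, ?_⟩
  · intro y
    have := hl (e.symm y)
    rw [← he, e.apply_symm_apply] at this
    rw [inv_mul_eq_div, le_div_iff₀ hr, mul_comm]
    exact this
  · intro x
    simp [← he]
  · intro y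
    exact ⟨e.symm y, rfl, by rw [← he, e.apply_symm_apply]⟩

/-- An admissible cut-off: a bounded function on `[0, ∞)`, vanishing at `0`, with bounded right
derivative. -/
structure IsCutoff (χ χ' : ℝ → ℝ) (B : ℝ) : Prop where
  map_zero : χ 0 = 0
  cont : ContinuousOn χ (Ici 0)
  deriv : ∀ t, 0 ≤ t → HasDerivWithinAt χ (χ' t) (Ioi t) t
  bound : ∀ t, 0 ≤ t → |χ t| ≤ B
  bound_deriv : ∀ t, 0 ≤ t → |χ' t| ≤ B

namespace IsCutoff

variable {χ χ' : ℝ → ℝ} {B : ℝ}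

theorem aestronglyMeasurable (h : IsCutoff χ χ' B) :
    AEStronglyMeasurable χ (volume.restrict (Ioi 0)) :=
  (h.cont.mono Ioi_subset_Ici_self).aestronglyMeasurable measurableSet_Ioi

theorem aestronglyMeasurable_deriv (h : IsCutoff χ χ' B) :
    AEStronglyMeasurable χ' (volume.restrict (Ioi 0)) := by
  refine (stronglyMeasurable_derivWithin_Ioi χ).aestronglyMeasurable.congr ?_
  filter_upwards [ae_restrict_mem measurableSet_Ioi] with t ht
  exact (h.deriv t (le_of_lt ht)).derivWithin (uniqueDiffWithinAt_Ioi t)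

end IsCutoff

theorem norm_smul_apply_le_of_growth {H : Type*} [NormedAddCommGroup H] [InnerProductSpace ℂ H]
    {S : ℝ → H →L[ℂ] H} {C ν : ℝ} (hC : ∀ t, 0 ≤ t → ‖S t‖ ≤ C * Real.exp (ν * t)) {B b t : ℝ}
    (ht : 0 ≤ t) (hb : |b| ≤ B) (x : H) :
    ‖b • S t x‖ ≤ B * C * ‖x‖ * Real.exp (ν * t) := by
  rw [norm_smul, Real.norm_eq_abs]
  calc |b| * ‖S t x‖ ≤ B * (C * Real.exp (ν * t) * ‖x‖) := by
        have := (S t).le_of_opNorm_le (hC t ht) x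
        have : 0 ≤ B := (abs_nonneg _).trans hb
        gcongr
    _ = _ := by ring

section Energy

variable {H : Type*} [NormedAddCommGroup H] [InnerProductSpace ℂ H]
  {S : ℝ → H →L[ℂ] H} {D : Submodule ℂ H} {A : D →ₗ[ℂ] H} {ω r : ℝ} {C ν : ℝ} {χ χ' : ℝ → ℝ} {B : ℝ}

theorem IsC0Semigroup.aestronglyMeasurable (hS : IsC0Semigroup S) (x : H) :
    AEStronglyMeasurable (fun t => S t x) (volume.restrict (Ioi 0)) :=
  ((hS.cont x).mono Ioi_subset_Ici_self).aestronglyMeasurable measurableSet_Ioi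

theorem IsC0Semigroup.integrableOn_exp_smul (hS : IsC0Semigroup S)
    (hC : ∀ t, 0 ≤ t → ‖S t‖ ≤ C * Real.exp (ν * t)) {b : ℝ → ℝ}
    (hb : AEStronglyMeasurable b (volume.restrict (Ioi 0))) (hbB : ∀ t, 0 ≤ t → |b t| ≤ B) {z : ℂ}
    (hz : ν < z.re) (x : H) :
    IntegrableOn (fun t : ℝ => Complex.exp (-z * t) • b t • S t x) (Ioi 0) :=
  integrableOn_exp_smul_of_norm_le (hb.smul (hS.aestronglyMeasurable x))
    (fun t ht => norm_smul_apply_le_of_growth hC ht (hbB t ht) x) hz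

theorem IsC0Semigroup.memLp_two_exp_smul (hS : IsC0Semigroup S)
    (hC : ∀ t, 0 ≤ t → ‖S t‖ ≤ C * Real.exp (ν * t)) {b : ℝ → ℝ}
    (hb : AEStronglyMeasurable b (volume.restrict (Ioi 0))) (hbB : ∀ t, 0 ≤ t → |b t| ≤ B) {z : ℂ}
    (hz : ν < z.re) (x : H) :
    MemLp (fun t : ℝ => Complex.exp (-z * t) • b t • S t x) 2 (volume.restrict (Ioi 0)) :=
  memLp_two_exp_smul_of_norm_le (hb.smul (hS.aestronglyMeasurable x))
    (fun t ht => norm_smul_apply_le_of_growth hC ht (hbB t ht) x) hz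

theorem fourier_indicator_exp_smul (f : ℝ → H) (α τ : ℝ) :
    𝓕 (indicator (Ioi 0) fun t : ℝ => Complex.exp (-(α : ℂ) * t) • f t) τ =
      ∫ t in Ioi (0 : ℝ), Complex.exp (-(⟨α, 2 * Real.pi * τ⟩ : ℂ) * t) • f t := by
  rw [Real.fourier_real_eq_integral_exp_smul, ← integral_indicator measurableSet_Ioi]
  congr 1 with t
  by_cases ht : t ∈ Ioi (0 : ℝ)
  · rw [indicator_of_mem ht, indicator_of_mem ht, smul_smul, ← Complex.exp_add]
    congr 2
    apply Complex.ext <;> simp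
    ring
  · rw [indicator_of_notMem ht, indicator_of_notMem ht, smul_zero]

theorem norm_sq_exp_smul (α t b : ℝ) (v : H) :
    ‖Complex.exp (-(α : ℂ) * t) • b • v‖ ^ 2 = b ^ 2 * Real.exp (-2 * α * t) * ‖v‖ ^ 2 := by
  rw [norm_smul, norm_smul, Complex.norm_exp, mul_pow, mul_pow, ← Real.exp_nat_mul,
    Real.norm_eq_abs, sq_abs]
  simp
  ring_nf

theorem IsC0Semigroup.integrableOn_sq_mul (hS : IsC0Semigroup S)
    (hC : ∀ t, 0 ≤ t → ‖S t‖ ≤ C * Real.exp (ν * t)) {b : ℝ → ℝ}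
    (hb : AEStronglyMeasurable b (volume.restrict (Ioi 0))) (hbB : ∀ t, 0 ≤ t → |b t| ≤ B) {α : ℝ}
    (hα : ν < α) (x : H) :
    IntegrableOn (fun t : ℝ => b t ^ 2 * Real.exp (-2 * α * t) * ‖S t x‖ ^ 2) (Ioi 0) := by
  have h := hS.memLp_two_exp_smul hC hb hbB (z := α) (by simpa using hα) x
  have h' := (memLp_two_iff_integrable_sq_norm h.aestronglyMeasurable).1 h
  simp only [norm_sq_exp_smul] at h'
  exact h'

variable [CompleteSpace H]

theorem integral_exp_smul_deriv_eq_zero (hS : IsC0Semigroup S)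
    (hA : IsGenerator S D A) (hC : ∀ t, 0 ≤ t → ‖S t‖ ≤ C * Real.exp (ν * t))
    (hχ : IsCutoff χ χ' B) {z : ℂ} (hz : ν < z.re) (x : D) :
    ∫ t in Ioi (0 : ℝ), (Complex.exp (-z * t) • χ' t • S t x
      + Complex.exp (-z * t) • χ t • S t (A x) - z • Complex.exp (-z * t) • χ t • S t x) = 0 := by
  have i1 := hS.integrableOn_exp_smul hC hχ.aestronglyMeasurable_deriv hχ.bound_deriv hz x
  have i2 := hS.integrableOn_exp_smul hC hχ.aestronglyMeasurable hχ.bound hz (A x)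
  have i3 := hS.integrableOn_exp_smul hC hχ.aestronglyMeasurable hχ.bound hz x
  have i4 := (i1.add i2).sub (i3.smul z)
  have hlim := intervalIntegral_tendsto_integral_Ioi 0 i4 tendsto_id
  refine tendsto_nhds_unique hlim ?_
  have hFTC : ∀ N : ℝ, 0 ≤ N → ∫ t in (0 : ℝ)..N, (Complex.exp (-z * t) • χ' t • S t x
      + Complex.exp (-z * t) • χ t • S t (A x) - z • Complex.exp (-z * t) • χ t • S t x)
      = Complex.exp (-z * N) • χ N • S N x := by
    intro N hN
    have h0 : Complex.exp (-z * N) • χ N • S N x = Complex.exp (-z * N) • χ N • S N x -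
      Complex.exp (-z * (0 : ℝ)) • χ 0 • S 0 x := by simp [hχ.map_zero]
    rw [h0]
    refine intervalIntegral.integral_eq_sub_of_hasDeriv_right_of_le hN
      (f := fun t : ℝ => Complex.exp (-z * t) • χ t • S t x) ?_ ?_ ?_
    · have h1 : ContinuousOn (fun t : ℝ => χ t • S t x) (Icc 0 N) :=
        (hχ.cont.smul (hS.cont x)).mono Icc_subset_Ici_self
      exact (by fun_prop : Continuous fun t : ℝ => Complex.exp (-z * t)).continuousOn.smul h1
    · intro t ht
      have ht0 : 0 ≤ t := ht.1.le
      have d1 : HasDerivWithinAt (fun s => S s (x : H)) (S t (A x)) (Ioi t) t := by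
        have := hA.hasDeriv x t ht0
        rw [hA.commutes x t ht0] at this
        exact this.mono fun s hs => ht0.trans (le_of_lt hs)
      have d2 := (hχ.deriv t ht0).smul d1
      have d3 : HasDerivAt (fun s : ℝ => Complex.exp (-z * s)) (Complex.exp (-z * t) * (-z * 1)) t :=
        ((hasDerivAt_id (t : ℂ)).const_mul (-z)).cexp.comp_ofReal
      have d4 := (d3.hasDerivWithinAt (s := Ioi t)).smul d2
      refine d4.congr_deriv ?_
      simp only [Pi.smul_apply', ← Complex.coe_smul]
      module
    · exact (intervalIntegrable_iff_integrableOn_Ioc_of_le hN).2 (i4.mono_set Ioc_subset_Ioi_self)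
  have hbd : ∀ N : ℝ, 0 ≤ N → ‖Complex.exp (-z * N) • χ N • S N x‖ ≤
      B * C * ‖(x : H)‖ * Real.exp (-(z.re - ν) * N) := by
    intro N hN
    rw [norm_smul, Complex.norm_exp]
    calc _ ≤ Real.exp (-z * N : ℂ).re * (B * C * ‖(x : H)‖ * Real.exp (ν * N)) := by
          gcongr; exact norm_smul_apply_le_of_growth hC hN (hχ.bound N hN) (x : H)
      _ = _ := by
          rw [mul_left_comm, ← Real.exp_add]
          simp
          ring_nf
          simp
  have hz0 : Tendsto (fun N : ℝ => B * C * ‖(x : H)‖ * Real.exp (-(z.re - ν) * N)) atTop (𝓝 0) := by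
    rw [← mul_zero (B * C * ‖(x : H)‖)]
    refine Tendsto.const_mul _ (Real.tendsto_exp_atBot.comp ?_)
    exact tendsto_id.const_mul_atTop_of_neg (by linarith)
  have hg := squeeze_zero_norm' ((eventually_ge_atTop 0).mono hbd) hz0
  exact hg.congr' ((eventually_ge_atTop 0).mono fun N hN => (hFTC N hN).symm)

/-- The Laplace transform of `χ • S x` lies in the domain of the generator, and `z - A` maps it to
the Laplace transform of `χ' • S x`. -/
theorem exists_laplace_eq (hS : IsC0Semigroup S) (hA : IsGenerator S D A) (hr : 0 < r)
    (hres : ResolventBound D A ω r) (hC : ∀ t, 0 ≤ t → ‖S t‖ ≤ C * Real.exp (ν * t))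
    (hχ : IsCutoff χ χ' B) {z : ℂ} (hz : ν < z.re) (x : D) :
    ∃ y : D, (y : H) = (∫ t in Ioi (0 : ℝ), Complex.exp (-z * t) • χ t • S t x) ∧
      z • (y : H) - A y = ∫ t in Ioi (0 : ℝ), Complex.exp (-z * t) • χ' t • S t x := by
  have i1 := hS.integrableOn_exp_smul hC hχ.aestronglyMeasurable_deriv hχ.bound_deriv hz x
  have i2 := hS.integrableOn_exp_smul hC hχ.aestronglyMeasurable hχ.bound hz (A x)
  have i3 := hS.integrableOn_exp_smul hC hχ.aestronglyMeasurable hχ.bound hz x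
  have h0 := integral_exp_smul_deriv_eq_zero hS hA hC hχ hz x
  rw [integral_sub (by exact i1.add i2) (by exact i3.smul z), integral_add i1 i2, integral_smul] at h0
  obtain ⟨R, hR1, hR2⟩ := hres.exists_resolvent hr (z := ((ω + 1 : ℝ) : ℂ)) (by simp)
  set z₀ : ℂ := ((ω + 1 : ℝ) : ℂ)
  obtain ⟨y, hy, hy'⟩ := hR2 (z₀ • (∫ t in Ioi (0 : ℝ), Complex.exp (-z * t) • χ t • S t x)
    - ∫ t in Ioi (0 : ℝ), Complex.exp (-z * t) • χ t • S t (A x))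
  have hyv : (y : H) = ∫ t in Ioi (0 : ℝ), Complex.exp (-z * t) • χ t • S t x := by
    rw [hy, ← integral_smul, ← integral_sub (by exact i3.smul z₀) i2,
      ← ContinuousLinearMap.integral_comp_comm R (by exact (i3.smul z₀).sub i2)]
    refine setIntegral_congr_fun measurableSet_Ioi fun t ht => ?_
    have ht0 : 0 ≤ t := le_of_lt ht
    have h := hR1 ((Complex.exp (-z * t) * (χ t : ℂ)) • ⟨S t x, hA.mem x t ht0⟩)
    rw [map_smul, hA.commutes x t ht0, Submodule.coe_smul, mul_smul, mul_smul] at h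
    simpa only [Complex.coe_smul] using h
  refine ⟨y, hyv, ?_⟩
  rw [hyv, sub_right_inj] at hy'
  rw [hy', hyv, eq_comm, ← sub_eq_zero, ← h0]
  abel

/-- The weighted energy inequality `r² ∫ χ² e^{-2αt} ‖S(t)x‖² ≤ ∫ χ'² e^{-2αt} ‖S(t)x‖²`. -/
theorem sq_mul_integral_cutoff_le (hS : IsC0Semigroup S) (hA : IsGenerator S D A) (hr : 0 < r)
    (hres : ResolventBound D A ω r) (hC : ∀ t, 0 ≤ t → ‖S t‖ ≤ C * Real.exp (ν * t))
    (hχ : IsCutoff χ χ' B) {α : ℝ} (hα : ν < α) (hωα : ω ≤ α) (x : D) :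
    r ^ 2 * ∫ t in Ioi (0 : ℝ), χ t ^ 2 * Real.exp (-2 * α * t) * ‖S t x‖ ^ 2 ≤
      ∫ t in Ioi (0 : ℝ), χ' t ^ 2 * Real.exp (-2 * α * t) * ‖S t x‖ ^ 2 := by
  have hz : ν < (α : ℂ).re := by simpa using hα
  have key := sq_mul_integral_norm_sq_le_of_fourier
    ((hS.integrableOn_exp_smul hC hχ.aestronglyMeasurable hχ.bound hz x).integrable_indicator
      measurableSet_Ioi)
    ((memLp_indicator_iff_restrict measurableSet_Ioi).2
      (hS.memLp_two_exp_smul hC hχ.aestronglyMeasurable hχ.bound hz x))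
    ((hS.integrableOn_exp_smul hC hχ.aestronglyMeasurable_deriv hχ.bound_deriv hz
      x).integrable_indicator measurableSet_Ioi)
    ((memLp_indicator_iff_restrict measurableSet_Ioi).2
      (hS.memLp_two_exp_smul hC hχ.aestronglyMeasurable_deriv hχ.bound_deriv hz x)) hr
    fun τ => by
      rw [fourier_indicator_exp_smul (fun t => χ t • S t x),
        fourier_indicator_exp_smul (fun t => χ' t • S t x)]
      obtain ⟨y, hy, hy'⟩ := exists_laplace_eq hS hA hr hres hC hχ
        (z := ⟨α, 2 * Real.pi * τ⟩) hα x
      rw [← hy, ← hy']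
      exact hres.le_of_le hωα y
  have hind : ∀ b : ℝ → ℝ, ∫ t, ‖indicator (Ioi 0)
      (fun t : ℝ => Complex.exp (-(α : ℂ) * t) • b t • S t x) t‖ ^ 2 =
      ∫ t in Ioi (0 : ℝ), b t ^ 2 * Real.exp (-2 * α * t) * ‖S t x‖ ^ 2 := by
    intro b
    rw [← integral_indicator measurableSet_Ioi]
    congr 1 with t
    by_cases ht : t ∈ Ioi (0 : ℝ)
    · rw [indicator_of_mem ht, indicator_of_mem ht, norm_sq_exp_smul]
    · rw [indicator_of_notMem ht, indicator_of_notMem ht, norm_zero]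
      norm_num
  rwa [hind, hind] at key

end Energy

section Growth

variable {H : Type*} [NormedAddCommGroup H] [InnerProductSpace ℂ H]
  {S : ℝ → H →L[ℂ] H} {D : Submodule ℂ H} {A : D →ₗ[ℂ] H} {ω r : ℝ} {C ν : ℝ}

theorem opNorm_le_of_dense {L : H →L[ℂ] H} (hD : Dense (D : Set H)) {K : ℝ} (hK : 0 ≤ K)
    (h : ∀ x : D, ‖L x‖ ≤ K * ‖(x : H)‖) : ‖L‖ ≤ K := by
  refine L.opNorm_le_bound hK fun x => ?_
  have hcl : IsClosed {x : H | ‖L x‖ ≤ K * ‖x‖} := isClosed_le (by fun_prop) (by fun_prop)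
  exact hcl.closure_subset_iff.2 (fun y hy => h ⟨y, hy⟩) (hD x)

theorem IsC0Semigroup.norm_apply_le (hS : IsC0Semigroup S) {s t : ℝ} (hs : 0 ≤ s) (hst : s ≤ t)
    (x : H) : ‖S t x‖ ≤ ‖S (t - s)‖ * ‖S s x‖ := by
  have := hS.map_add (t - s) (sub_nonneg.2 hst) s hs
  rw [sub_add_cancel] at this
  rw [this]
  exact (S (t - s)).le_opNorm _

theorem IsC0Semigroup.exists_growth (hS : IsC0Semigroup S) {m : ℝ → ℝ} (hm : ContinuousOn m (Ici 0))
    (hSm : ∀ t, 0 ≤ t → ‖S t‖ ≤ m t) : ∃ C ν, ∀ t, 0 ≤ t → ‖S t‖ ≤ C * Real.exp (ν * t) := by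
  obtain ⟨K, hK⟩ := (isCompact_Icc (a := (0 : ℝ)) (b := 1)).bddAbove_image
    (hm.mono Icc_subset_Ici_self)
  set M := max K 1
  have hM1 : 1 ≤ M := le_max_right _ _
  have hM : ∀ t ∈ Icc (0 : ℝ) 1, ‖S t‖ ≤ M := fun t ht =>
    (hSm t ht.1).trans ((hK (mem_image_of_mem m ht)).trans (le_max_left _ _))
  have hn : ∀ n : ℕ, ∀ t ∈ Icc (0 : ℝ) 1, ‖S (n + t)‖ ≤ M * M ^ n := by
    intro n
    induction n with
    | zero => intro t ht; simpa using hM t ht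
    | succ k ih =>
      intro t ht
      have : ((k + 1 : ℕ) : ℝ) + t = 1 + (k + t) := by push_cast; ring
      rw [this, hS.map_add 1 zero_le_one _ (add_nonneg (Nat.cast_nonneg k) ht.1)]
      calc _ ≤ ‖S 1‖ * ‖S (k + t)‖ := ContinuousLinearMap.opNorm_comp_le _ _
        _ ≤ M * (M * M ^ k) := by
            gcongr
            · exact hM 1 (by simp)
            · exact ih t ht
        _ = _ := by ring
  refine ⟨M, Real.log M, fun t ht => ?_⟩
  have h1 := hn ⌊t⌋₊ (t - ⌊t⌋₊) ⟨sub_nonneg.2 (Nat.floor_le ht), by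
    linarith [Nat.lt_floor_add_one t]⟩
  rw [add_sub_cancel] at h1
  refine h1.trans ?_
  rw [← Real.rpow_def_of_pos (by linarith), ← Real.rpow_natCast]
  gcongr
  exact Nat.floor_le ht

/-- The cut-off `t ↦ sinh (r min(t, T))`. -/
theorem isCutoff_sinh (hr : 0 < r) {T : ℝ} (hT : 0 ≤ T) :
    IsCutoff (fun t => Real.sinh (r * min t T)) (fun t => if t < T then r * Real.cosh (r * t) else 0)
      ((1 + r) * Real.cosh (r * T)) where
  map_zero := by simp [hT]
  cont := by fun_prop
  deriv t ht := by
    split_ifs with h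
    · have h1 : HasDerivAt (fun s => Real.sinh (r * s)) (Real.cosh (r * t) * (r * 1)) t :=
        ((hasDerivAt_id t).const_mul r).sinh
      rw [mul_one, mul_comm] at h1
      refine (h1.congr_of_eventuallyEq ?_).hasDerivWithinAt
      filter_upwards [Iio_mem_nhds h] with s hs
      rw [min_eq_left (le_of_lt hs)]
    · refine (hasDerivWithinAt_const t (Ioi t) (Real.sinh (r * T))).congr ?_ ?_
      · intro s hs
        rw [min_eq_right ((not_lt.1 h).trans (le_of_lt hs))]
      · rw [min_eq_right (not_lt.1 h)]
  bound t ht := by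
    have h0 : 0 ≤ r * min t T := mul_nonneg hr.le (le_min ht hT)
    rw [abs_of_nonneg (Real.sinh_nonneg_iff.2 h0)]
    calc Real.sinh (r * min t T) ≤ Real.cosh (r * min t T) := (Real.sinh_lt_cosh _).le
      _ ≤ Real.cosh (r * T) := by
        rw [Real.cosh_le_cosh, abs_of_nonneg h0, abs_of_nonneg (by positivity)]
        gcongr
        exact min_le_right _ _
      _ ≤ _ := le_mul_of_one_le_left (Real.cosh_pos _).le (by linarith)
  bound_deriv t ht := by
    split_ifs with h
    · rw [abs_of_nonneg (mul_nonneg hr.le (Real.cosh_pos _).le)]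
      have : Real.cosh (r * t) ≤ Real.cosh (r * T) := by
        rw [Real.cosh_le_cosh, abs_of_nonneg (by positivity), abs_of_nonneg (by positivity)]
        gcongr
      have := Real.cosh_pos (r * t)
      gcongr
      linarith
    · rw [abs_zero]
      have := Real.cosh_pos (r * T)
      positivity

variable [CompleteSpace H]

theorem integral_nonpos_of_le_cutoff {χ χ' : ℝ → ℝ} {B : ℝ} (hS : IsC0Semigroup S)
    (hA : IsGenerator S D A) (hr : 0 < r)
    (hres : ResolventBound D A ω r) (hC : ∀ t, 0 ≤ t → ‖S t‖ ≤ C * Real.exp (ν * t))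
    (hχ : IsCutoff χ χ' B) {α : ℝ} (hα : ν < α) (hωα : ω ≤ α) (x : D) {h : ℝ → ℝ}
    (hi : IntegrableOn h (Ioi 0))
    (hle : ∀ t, 0 < t →
      h t ≤ (r ^ 2 * χ t ^ 2 - χ' t ^ 2) * Real.exp (-2 * α * t) * ‖S t x‖ ^ 2) :
    ∫ t in Ioi (0 : ℝ), h t ≤ 0 := by
  have i1 := (hS.integrableOn_sq_mul hC hχ.aestronglyMeasurable hχ.bound hα x).const_mul (r ^ 2)
  have i2 := hS.integrableOn_sq_mul hC hχ.aestronglyMeasurable_deriv hχ.bound_deriv hα x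
  calc _ ≤ ∫ t in Ioi (0 : ℝ), (r ^ 2 * (χ t ^ 2 * Real.exp (-2 * α * t) * ‖S t x‖ ^ 2)
        - χ' t ^ 2 * Real.exp (-2 * α * t) * ‖S t x‖ ^ 2) := by
        refine setIntegral_mono_on hi (i1.sub i2) measurableSet_Ioi fun t ht => ?_
        refine (hle t ht).trans_eq ?_
        ring
    _ ≤ 0 := by
        rw [integral_sub (by exact i1) (by exact i2), integral_const_mul, sub_nonpos]
        exact sq_mul_integral_cutoff_le hS hA hr hres hC hχ hα hωα x

/-- An exponential growth rate `ν ≥ ω` can be improved to `ν - r / 2`. -/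
theorem IsC0Semigroup.improve_growth (hS : IsC0Semigroup S)
    (hA : IsGenerator S D A) (hr : 0 < r) (hres : ResolventBound D A ω r)
    (hC : ∀ t, 0 ≤ t → ‖S t‖ ≤ C * Real.exp (ν * t)) (hων : ω ≤ ν) :
    ∃ C', ∀ t, 0 ≤ t → ‖S t‖ ≤ C' * Real.exp ((ν - r / 2) * t) := by
  have hC0 : 0 ≤ C := by simpa using (norm_nonneg _).trans (hC 0 le_rfl)
  set α := ν + r / 2 with hα_def
  have hα : ν < α := by linarith
  set J := ∫ t in Ioi (0 : ℝ), Real.exp (-r * t) with hJ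
  set M := (C + 1) * Real.exp |ν| with hM_def
  have hM : 0 < M := by positivity
  have hJ0 : 0 ≤ J := integral_nonneg fun t => (Real.exp_pos _).le
  set K := 2 * M * C * Real.exp |α| * √J with hK
  have hK0 : 0 ≤ K := by positivity
  have main : ∀ T, 0 ≤ T → ∀ x : D, ‖S (T + 1) x‖ ≤ K * Real.exp ((ν - r / 2) * T) * ‖(x : H)‖ := by
    intro T hT x
    set κ := Real.cosh (r * T) ^ 2 * (Real.exp (-2 * α * T - 2 * |α|) * (‖S (T + 1) x‖ / M) ^ 2)
      with hκ
    have hw : ∀ t, 0 ≤ t →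
        Real.exp (-2 * α * t) * ‖S t x‖ ^ 2 ≤ C ^ 2 * ‖(x : H)‖ ^ 2 * Real.exp (-r * t) := by
      intro t ht
      calc _ ≤ Real.exp (-2 * α * t) * (C * Real.exp (ν * t) * ‖(x : H)‖) ^ 2 := by
            gcongr
            exact (S t).le_of_opNorm_le (hC t ht) x
        _ = C ^ 2 * ‖(x : H)‖ ^ 2 * (Real.exp (-2 * α * t) * Real.exp (ν * t) ^ 2) := by ring
        _ = _ := by
            rw [← Real.exp_nat_mul, ← Real.exp_add, hα_def]
            push_cast
            ring_nf
    have hw' : ∀ t ∈ Ioc T (T + 1), Real.exp (-2 * α * T - 2 * |α|) * (‖S (T + 1) x‖ / M) ^ 2 ≤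
        Real.exp (-2 * α * t) * ‖S t x‖ ^ 2 := by
      intro t ht
      have h1 : 0 ≤ t := hT.trans ht.1.le
      have h2 : ‖S (T + 1 - t)‖ ≤ M := by
        refine (hC _ (by linarith [ht.2])).trans ?_
        have : ν * (T + 1 - t) ≤ |ν| := by
          calc _ ≤ |ν| * (T + 1 - t) := by
                gcongr
                · linarith [ht.2]
                · exact le_abs_self ν
            _ ≤ |ν| * 1 := by
                gcongr
                linarith [ht.1]
            _ = _ := mul_one _
        rw [hM_def]
        gcongr
        linarith
      have h3 : ‖S (T + 1) x‖ / M ≤ ‖S t x‖ := by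
        rw [div_le_iff₀' hM]
        exact (hS.norm_apply_le h1 ht.2 x).trans (by gcongr)
      have h4 : α * (t - T) ≤ |α| := by
        calc _ ≤ |α| * (t - T) := by
                gcongr
                · linarith [ht.1]
                · exact le_abs_self α
            _ ≤ |α| * 1 := by
                gcongr
                linarith [ht.2]
            _ = _ := mul_one _
      gcongr
      linarith
    have hJi : IntegrableOn (fun t : ℝ => Real.exp (-r * t)) (Ioi 0) := exp_neg_integrableOn_Ioi 0 hr
    have hκi : IntegrableOn (indicator (Ioc T (T + 1)) fun _ => κ) (Ioi 0) :=
      (((integrableOn_const (by simp)).integrable_indicator measurableSet_Ioc)).integrableOn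
    have key := integral_nonpos_of_le_cutoff hS hA hr hres hC (isCutoff_sinh hr hT) hα
      (by linarith) x (h := fun t => r ^ 2 * (indicator (Ioc T (T + 1)) (fun _ => κ) t -
        C ^ 2 * ‖(x : H)‖ ^ 2 * Real.exp (-r * t))) (by
        exact Integrable.const_mul (Integrable.sub hκi (hJi.const_mul (C ^ 2 * ‖(x : H)‖ ^ 2))) (r ^ 2))
      (by
        intro t ht
        have e1 := hw t ht.le
        have e0 : 0 ≤ Real.exp (-2 * α * t) * ‖S t x‖ ^ 2 := by positivity
        have e2 : r ^ 2 * indicator (Ioc T (T + 1)) (fun _ => κ) t ≤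
            (r ^ 2 * Real.sinh (r * min t T) ^ 2 - (if t < T then r * Real.cosh (r * t) else 0) ^ 2
              + r ^ 2) * (Real.exp (-2 * α * t) * ‖S t x‖ ^ 2) := by
          split_ifs with h
          · rw [indicator_of_notMem (fun h' => (lt_asymm h h'.1)), min_eq_left h.le, mul_pow,
              Real.cosh_sq]
            refine le_of_eq ?_
            ring
          · have hc : r ^ 2 * Real.sinh (r * min t T) ^ 2 - (0 : ℝ) ^ 2 + r ^ 2 =
                r ^ 2 * Real.cosh (r * T) ^ 2 := by
              rw [min_eq_right (not_lt.1 h), Real.cosh_sq]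
              ring
            rw [hc]
            by_cases h' : t ∈ Ioc T (T + 1)
            · rw [indicator_of_mem h', hκ, ← mul_assoc]
              exact mul_le_mul_of_nonneg_left (hw' t h') (by positivity)
            · rw [indicator_of_notMem h', mul_zero]
              positivity
        have e3 := mul_le_mul_of_nonneg_left e1 (sq_nonneg r)
        linear_combination e2 + e3)
    have hsub : Ioi (0 : ℝ) ∩ Ioc T (T + 1) = Ioc T (T + 1) :=
      inter_eq_right.2 fun t ht => hT.trans_lt ht.1
    rw [integral_const_mul, integral_sub (by exact hκi) (by exact hJi.const_mul _),
      integral_const_mul, ← hJ, setIntegral_indicator measurableSet_Ioc,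
      hsub, setIntegral_const] at key
    have key2 : κ ≤ C ^ 2 * ‖(x : H)‖ ^ 2 * J := by
      have := nonpos_of_mul_nonpos_right key (by positivity)
      simpa using this
    have hcosh : Real.exp (r * T) / 2 ≤ Real.cosh (r * T) := by
      rw [Real.cosh_eq]
      linarith [Real.exp_pos (-(r * T))]
    have h5 : Real.cosh (r * T) * (Real.exp (-α * T - |α|) * (‖S (T + 1) x‖ / M)) ≤
        C * ‖(x : H)‖ * √J := by
      refine le_of_sq_le_sq ?_ (by positivity)
      calc _ = κ := by
            rw [hκ, mul_pow, mul_pow, ← Real.exp_nat_mul]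
            push_cast
            ring_nf
        _ ≤ _ := key2
        _ = _ := by rw [mul_pow, mul_pow, Real.sq_sqrt hJ0]
    have h6 : Real.exp (r * T) / 2 * (Real.exp (-α * T - |α|) * (‖S (T + 1) x‖ / M)) ≤
        C * ‖(x : H)‖ * √J := le_trans (by gcongr) h5
    have h7 : Real.exp (r * T) * Real.exp (-α * T - |α|) * Real.exp |α| *
        Real.exp ((ν - r / 2) * T) = 1 := by
      rw [← Real.exp_add, ← Real.exp_add, ← Real.exp_add, Real.exp_eq_one_iff, hα_def]
      ring
    calc ‖S (T + 1) x‖ = Real.exp (r * T) / 2 * (Real.exp (-α * T - |α|) * (‖S (T + 1) x‖ / M)) *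
          (2 * M * Real.exp |α| * Real.exp ((ν - r / 2) * T)) := by
          have h8 : M * (‖S (T + 1) x‖ / M) = ‖S (T + 1) x‖ := mul_div_cancel₀ _ hM.ne'
          linear_combination (-(M * (‖S (T + 1) x‖ / M))) * h7 - h8
      _ ≤ C * ‖(x : H)‖ * √J * (2 * M * Real.exp |α| * Real.exp ((ν - r / 2) * T)) := by gcongr
      _ = _ := by rw [hK]; ring
  set β := ν - r / 2
  refine ⟨K * Real.exp |β| + C * Real.exp (r / 2), fun t ht => ?_⟩
  rw [add_mul]
  rcases le_or_gt 1 t with h | h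
  · refine le_trans ?_ (le_add_of_nonneg_right (by positivity))
    refine opNorm_le_of_dense hA.dense (by positivity) fun x => ?_
    have h1 := main (t - 1) (by linarith) x
    rw [sub_add_cancel] at h1
    refine h1.trans ?_
    rw [mul_assoc K (Real.exp |β|), ← Real.exp_add]
    gcongr
    linarith [neg_abs_le β]
  · refine le_trans ?_ (le_add_of_nonneg_left (by positivity))
    refine (hC t ht).trans ?_
    rw [mul_assoc C, ← Real.exp_add]
    gcongr
    nlinarith

theorem IsC0Semigroup.exists_growth_lt (hS : IsC0Semigroup S)
    (hA : IsGenerator S D A) (hr : 0 < r) (hres : ResolventBound D A ω r)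
    (hC : ∀ t, 0 ≤ t → ‖S t‖ ≤ C * Real.exp (ν * t)) :
    ∃ C', ∃ ν' < ω, ∀ t, 0 ≤ t → ‖S t‖ ≤ C' * Real.exp (ν' * t) := by
  have step : ∀ n : ℕ, (∃ C', ∃ ν' < ω, ∀ t, 0 ≤ t → ‖S t‖ ≤ C' * Real.exp (ν' * t)) ∨
      ∃ C', ∀ t, 0 ≤ t → ‖S t‖ ≤ C' * Real.exp ((ν - n * (r / 2)) * t) := by
    intro n
    induction n with
    | zero => exact Or.inr ⟨C, by simpa using hC⟩
    | succ n ih =>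
      rcases ih with ih | ⟨C', h⟩
      · exact Or.inl ih
      rcases lt_or_ge (ν - n * (r / 2)) ω with h1 | h1
      · exact Or.inl ⟨C', _, h1, h⟩
      obtain ⟨C₂, h2⟩ := hS.improve_growth hA hr hres h h1
      refine Or.inr ⟨C₂, fun t ht => (h2 t ht).trans_eq ?_⟩
      push_cast
      ring_nf
  obtain ⟨n, hn⟩ := exists_nat_gt ((ν - ω) / (r / 2))
  rw [div_lt_iff₀ (by positivity)] at hn
  exact (step n).elim id fun ⟨C', h⟩ => ⟨C', _, by linarith, h⟩

end Growth

section Riccati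

/-- A solution `ψ` of `ψ' = r (ψ² + 2 μ ψ + 1)` on `[0, a]` running from `0` to `1`, extended by
constants, with the solutions `η` of `η' = - r ψ η` and `p` of `p' = 2 r μ p`. -/
structure RiccatiSystem (r a : ℝ) (μ ψ η p : ℝ → ℝ) : Prop where
  r_pos : 0 < r
  a_pos : 0 < a
  cont : Continuous ψ
  eq_zero : ∀ s ≤ 0, ψ s = 0
  eq_one : ψ a = 1
  nonneg : ∀ s, 0 ≤ ψ s
  le_one : ∀ s, ψ s ≤ 1
  lt_one : ∀ s < a, ψ s < 1
  deriv : ∀ s ∈ Ico 0 a, HasDerivWithinAt ψ (r * (ψ s ^ 2 + 2 * μ s * ψ s + 1)) (Ioi s) s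
  deriv_weight : ∀ s, HasDerivAt η (-r * ψ s * η s) s
  weight_pos : ∀ s, 0 < η s
  weight_eq_one : ∀ s ≤ 0, η s = 1
  deriv_density : ∀ s, 0 ≤ s → HasDerivWithinAt p (2 * r * μ s * p s) (Ici 0) s
  density_pos : ∀ s, 0 ≤ s → 0 < p s

variable {r a T : ℝ} {μ ψ η p : ℝ → ℝ}

/-- The cut-off built from a Riccati system: `ψ η / (r p)` on `[0, a]`, exponential growth with
rate `r` on `[a, T - a]`, and a multiple of `η (T - ·)` after that. -/
noncomputable def riccatiCutoff (r a T : ℝ) (ψ η p : ℝ → ℝ) (t : ℝ) : ℝ :=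
  ψ (min t a) * η (min t a) / (r * p (min t a)) *
    Real.exp (r * (min (max t a) (T - a) - a)) * (η (min (T - t) a) / η a)

/-- The right derivative of `riccatiCutoff`. -/
noncomputable def riccatiCutoffDeriv (r a T : ℝ) (ψ η p : ℝ → ℝ) (t : ℝ) : ℝ :=
  if t < a then η t / p t else r * ψ (min (T - t) a) * riccatiCutoff r a T ψ η p t

namespace RiccatiSystem

theorem continuous_weight (h : RiccatiSystem r a μ ψ η p) : Continuous η :=
  continuous_iff_continuousAt.2 fun s => (h.deriv_weight s).continuousAt

theorem continuousOn_density (h : RiccatiSystem r a μ ψ η p) : ContinuousOn p (Ici 0) :=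
  fun s hs => (h.deriv_density s hs).continuousWithinAt

theorem cutoff_of_le (h : RiccatiSystem r a μ ψ η p) (hT : 2 * a ≤ T) {t : ℝ} (ht : t ≤ a) :
    riccatiCutoff r a T ψ η p t = ψ t * η t / (r * p t) := by
  have h0 := (h.weight_pos a).ne'
  rw [riccatiCutoff, min_eq_left ht, max_eq_right ht, min_eq_left (by linarith : a ≤ T - a),
    min_eq_right (by linarith : a ≤ T - t), div_self h0]
  simp

theorem cutoff_of_mem_Icc (h : RiccatiSystem r a μ ψ η p) {t : ℝ}
    (ht : t ∈ Icc a (T - a)) :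
    riccatiCutoff r a T ψ η p t = η a / (r * p a) * Real.exp (r * (t - a)) := by
  have h0 := (h.weight_pos a).ne'
  rw [riccatiCutoff, min_eq_right ht.1, max_eq_left ht.1, min_eq_left ht.2,
    min_eq_right (by linarith [ht.2] : a ≤ T - t), div_self h0, h.eq_one]
  simp

theorem cutoff_of_ge (h : RiccatiSystem r a μ ψ η p) (hT : 2 * a ≤ T) {t : ℝ} (ht : T - a ≤ t) :
    riccatiCutoff r a T ψ η p t = Real.exp (r * (T - 2 * a)) / (r * p a) * η (T - t) := by
  have h0 := (h.weight_pos a).ne'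
  have h1 := (h.density_pos a h.a_pos.le).ne'
  have h2 := h.r_pos.ne'
  rw [riccatiCutoff, min_eq_right (by linarith : a ≤ t), max_eq_left (by linarith : a ≤ t),
    min_eq_right ht, min_eq_left (by linarith : T - t ≤ a), h.eq_one]
  have : r * (T - a - a) = r * (T - 2 * a) := by ring
  rw [this]
  field_simp

theorem continuousOn_cutoff (h : RiccatiSystem r a μ ψ η p) :
    ContinuousOn (riccatiCutoff r a T ψ η p) (Ici 0) := by
  have hψ := h.cont
  have hη := h.continuous_weight
  have hmin : ∀ t ∈ Ici (0 : ℝ), 0 ≤ min t a := fun t ht => le_min ht h.a_pos.le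
  have hp : ContinuousOn (fun t => p (min t a)) (Ici 0) :=
    h.continuousOn_density.comp (by fun_prop) hmin
  have hp0 : ∀ t ∈ Ici (0 : ℝ), r * p (min t a) ≠ 0 := fun t ht =>
    (mul_pos h.r_pos (h.density_pos _ (hmin t ht))).ne'
  refine ContinuousOn.mul (ContinuousOn.mul (ContinuousOn.div ?_ (hp.const_smul r) hp0) ?_) ?_ <;>
    exact Continuous.continuousOn (by fun_prop)

theorem hasDerivWithinAt_cutoff (h : RiccatiSystem r a μ ψ η p) (hT : 2 * a ≤ T) {t : ℝ}
    (ht : 0 ≤ t) : HasDerivWithinAt (riccatiCutoff r a T ψ η p)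
      (riccatiCutoffDeriv r a T ψ η p t) (Ioi t) t := by
  have hr := h.r_pos.ne'
  have ha := h.a_pos
  rcases lt_or_ge t a with h1 | h1
  · rw [riccatiCutoffDeriv, if_pos h1]
    have hp := h.density_pos t ht
    have d := ((h.deriv t ⟨ht, h1⟩).mul (h.deriv_weight t).hasDerivWithinAt).div
      (((h.deriv_density t ht).mono (Ioi_subset_Ici ht)).const_mul r)
      (mul_pos h.r_pos hp).ne'
    refine (d.congr_deriv ?_).congr_of_eventuallyEq ?_ (h.cutoff_of_le hT h1.le)
    · simp only [Pi.mul_apply]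
      field_simp
      ring
    · filter_upwards [mem_nhdsWithin_of_mem_nhds (Iio_mem_nhds h1)] with s hs
      exact h.cutoff_of_le hT (le_of_lt hs)
  rw [riccatiCutoffDeriv, if_neg (not_lt.2 h1)]
  rcases lt_or_ge t (T - a) with h2 | h2
  · rw [min_eq_right (by linarith : a ≤ T - t), h.eq_one, h.cutoff_of_mem_Icc ⟨h1, h2.le⟩]
    have d := ((((hasDerivAt_id t).sub_const a).const_mul r).exp.const_mul
      (η a / (r * p a))).hasDerivWithinAt (s := Ioi t)
    refine (d.congr_deriv ?_).congr_of_eventuallyEq ?_ (h.cutoff_of_mem_Icc ⟨h1, h2.le⟩)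
    · simp only [id]
      ring
    · filter_upwards [mem_nhdsWithin_of_mem_nhds (Iio_mem_nhds h2), self_mem_nhdsWithin] with s hs hs'
      exact h.cutoff_of_mem_Icc ⟨h1.trans (le_of_lt hs'), le_of_lt hs⟩
  · rw [min_eq_left (by linarith : T - t ≤ a), h.cutoff_of_ge hT h2]
    have d := (((h.deriv_weight (T - t)).comp_const_sub T t).const_mul
      (Real.exp (r * (T - 2 * a)) / (r * p a))).hasDerivWithinAt (s := Ioi t)
    refine (d.congr_deriv ?_).congr (fun s hs => h.cutoff_of_ge hT (h2.trans (le_of_lt hs)))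
      (h.cutoff_of_ge hT h2)
    ring

theorem exists_isCutoff (h : RiccatiSystem r a μ ψ η p) (hT : 2 * a ≤ T) :
    ∃ B, IsCutoff (riccatiCutoff r a T ψ η p) (riccatiCutoffDeriv r a T ψ η p) B := by
  have ha := h.a_pos
  have hr := h.r_pos
  obtain ⟨B₁, hB₁⟩ := (isCompact_Icc (a := (0 : ℝ)) (b := T)).exists_bound_of_continuousOn
    (h.continuousOn_cutoff.mono Icc_subset_Ici_self)
  obtain ⟨B₂, hB₂⟩ := (isCompact_Icc (a := (0 : ℝ)) (b := a)).exists_bound_of_continuousOn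
    (h.continuous_weight.continuousOn.div (h.continuousOn_density.mono Icc_subset_Ici_self)
      fun s hs => (h.density_pos s hs.1).ne')
  have hb : ∀ t, 0 ≤ t → |riccatiCutoff r a T ψ η p t| ≤ B₁ := by
    intro t ht
    rcases le_or_gt t T with h1 | h1
    · exact hB₁ t ⟨ht, h1⟩
    · have e : riccatiCutoff r a T ψ η p t = riccatiCutoff r a T ψ η p T := by
        rw [h.cutoff_of_ge hT (by linarith), h.cutoff_of_ge hT (by linarith),
          h.weight_eq_one _ (by linarith), h.weight_eq_one _ (by linarith)]
      rw [e]
      exact hB₁ T ⟨by linarith, le_rfl⟩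
  have hB₁0 : 0 ≤ B₁ := (abs_nonneg _).trans (hb 0 le_rfl)
  refine ⟨max B₁ (max B₂ (r * B₁)), ⟨?_, h.continuousOn_cutoff,
    fun t ht => h.hasDerivWithinAt_cutoff hT ht, fun t ht => (hb t ht).trans (le_max_left _ _), ?_⟩⟩
  · rw [h.cutoff_of_le hT ha.le, h.eq_zero 0 le_rfl]
    simp
  · intro t ht
    refine le_trans ?_ (le_max_right _ _)
    rw [riccatiCutoffDeriv]
    split_ifs with h1
    · exact (hB₂ t ⟨ht, h1.le⟩).trans (le_max_left _ _)
    · refine le_trans ?_ (le_max_right _ _)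
      rw [abs_mul, abs_mul, abs_of_pos hr, abs_of_nonneg (h.nonneg _)]
      calc _ ≤ r * 1 * B₁ := by
            gcongr
            · exact h.le_one _
            · exact hb t ht
        _ = _ := by ring

/-- The density of the energy defect `χ'² - r² χ²` of the cut-off. -/
theorem continuousOn_defect (h : RiccatiSystem r a μ ψ η p) :
    ContinuousOn (fun s => η s ^ 2 * (1 - ψ s ^ 2) / p s) (Icc 0 a) := by
  have hψ := h.cont
  have hη := h.continuous_weight
  exact (Continuous.continuousOn (by fun_prop)).div
    (h.continuousOn_density.mono Icc_subset_Ici_self) fun s hs => (h.density_pos s hs.1).ne'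

theorem defect_pos (h : RiccatiSystem r a μ ψ η p) {s : ℝ} (hs : s ∈ Ioo 0 a) :
    0 < η s ^ 2 * (1 - ψ s ^ 2) / p s := by
  have h1 := h.weight_pos s
  have h2 := h.density_pos s hs.1.le
  have h3 : 0 < 1 - ψ s ^ 2 := by nlinarith [h.lt_one s hs.2, h.nonneg s]
  positivity

theorem sq_cutoff_sub_of_le (h : RiccatiSystem r a μ ψ η p) (hT : 2 * a ≤ T) {t : ℝ}
    (ht : t ∈ Ioc 0 a) : r ^ 2 * riccatiCutoff r a T ψ η p t ^ 2 -
      riccatiCutoffDeriv r a T ψ η p t ^ 2 = -(η t ^ 2 * (1 - ψ t ^ 2) / p t) / p t := by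
  have hr := h.r_pos.ne'
  have hp := (h.density_pos t ht.1.le).ne'
  rw [riccatiCutoffDeriv]
  split_ifs with h1
  · rw [h.cutoff_of_le hT ht.2]
    field_simp
    ring
  · obtain rfl : t = a := le_antisymm ht.2 (not_lt.1 h1)
    rw [min_eq_right (by linarith : t ≤ T - t), h.eq_one]
    ring

theorem sq_cutoff_sub_nonneg (h : RiccatiSystem r a μ ψ η p) {t : ℝ} (ht : a ≤ t) :
    0 ≤ r ^ 2 * riccatiCutoff r a T ψ η p t ^ 2 - riccatiCutoffDeriv r a T ψ η p t ^ 2 := by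
  rw [riccatiCutoffDeriv, if_neg (not_lt.2 ht)]
  have h3 : 0 ≤ 1 - ψ (min (T - t) a) ^ 2 := by
    nlinarith [h.le_one (min (T - t) a), h.nonneg (min (T - t) a)]
  have := mul_nonneg (sq_nonneg (r * riccatiCutoff r a T ψ η p t)) h3
  linear_combination this

theorem sq_cutoff_sub_of_ge (h : RiccatiSystem r a μ ψ η p) (hT : 2 * a ≤ T) {t : ℝ}
    (ht : T - a ≤ t) : r ^ 2 * riccatiCutoff r a T ψ η p t ^ 2 -
      riccatiCutoffDeriv r a T ψ η p t ^ 2 =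
        (Real.exp (r * (T - 2 * a)) / p a) ^ 2 * (η (T - t) ^ 2 * (1 - ψ (T - t) ^ 2)) := by
  have hr := h.r_pos.ne'
  have hp := (h.density_pos a h.a_pos.le).ne'
  have ha := h.a_pos
  rw [riccatiCutoffDeriv, if_neg (by linarith), min_eq_left (by linarith : T - t ≤ a),
    h.cutoff_of_ge hT ht]
  field_simp

end RiccatiSystem

variable {H : Type*} [NormedAddCommGroup H] [InnerProductSpace ℂ H] [CompleteSpace H]
  {S : ℝ → H →L[ℂ] H} {D : Submodule ℂ H} {A : D →ₗ[ℂ] H} {ω C ν : ℝ} {m : ℝ → ℝ}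

theorem RiccatiSystem.norm_apply_le (h : RiccatiSystem r a μ ψ η p) (hS : IsC0Semigroup S)
    (hA : IsGenerator S D A) (hres : ResolventBound D A ω r)
    (hC : ∀ t, 0 ≤ t → ‖S t‖ ≤ C * Real.exp (ν * t)) (hνω : ν < ω)
    (hm : ∀ t, 0 ≤ t → ‖S t‖ ≤ m t) (hp : ∀ t, 0 ≤ t → p t = Real.exp (-2 * ω * t) * m t ^ 2)
    (hT : 2 * a ≤ T) (x : D) :
    ‖S T x‖ ≤ Real.exp ((ω - r) * (T - 2 * a)) * m a ^ 2 * ‖(x : H)‖ := by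
  have ha := h.a_pos
  have hpa := h.density_pos a ha.le
  obtain ⟨B, hχ⟩ := h.exists_isCutoff hT
  set k : ℝ → ℝ := fun s => η s ^ 2 * (1 - ψ s ^ 2) / p s with hk
  set c := Real.exp (r * (T - 2 * a)) / p a with hc
  set E := Real.exp (-2 * ω * T) * ‖S T x‖ ^ 2 with hE
  have hkc : ContinuousOn k (uIcc 0 a) := by
    rw [uIcc_of_le ha.le]
    exact h.continuousOn_defect
  have hki : IntervalIntegrable k volume 0 a := hkc.intervalIntegrable
  have hki' : IntervalIntegrable (fun t => k (T - t)) volume (T - a) T := by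
    have := (hki.comp_sub_left T).symm
    rwa [sub_zero] at this
  have hK : 0 < ∫ s in (0 : ℝ)..a, k s :=
    intervalIntegral.intervalIntegral_pos_of_pos_on hki (fun s hs => h.defect_pos hs) ha
  have hTa : T - a ≤ T := by linarith
  have i1 : IntegrableOn (indicator (Ioc 0 a) fun t => -‖(x : H)‖ ^ 2 * k t) (Ioi 0) :=
    ((integrable_indicator_iff measurableSet_Ioc).2 (hki.1.const_mul _)).integrableOn
  have i2 : IntegrableOn (indicator (Ioc (T - a) T) fun t => c ^ 2 * E * k (T - t)) (Ioi 0) :=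
    ((integrable_indicator_iff measurableSet_Ioc).2 (hki'.1.const_mul _)).integrableOn
  have key := integral_nonpos_of_le_cutoff hS hA h.r_pos hres hC hχ hνω le_rfl x
    (h := fun t => indicator (Ioc 0 a) (fun t => -‖(x : H)‖ ^ 2 * k t) t +
      indicator (Ioc (T - a) T) (fun t => c ^ 2 * E * k (T - t)) t) (by exact Integrable.add i1 i2)
    (by
      intro t ht
      by_cases h1 : t ∈ Ioc 0 a
      · rw [indicator_of_mem h1, indicator_of_notMem (fun h' => by linarith [h'.1, h1.2]), add_zero,
          h.sq_cutoff_sub_of_le hT h1, mul_assoc]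
        have hpt := h.density_pos t ht.le
        have hkt : 0 ≤ k t := by
          have h3 : 0 ≤ 1 - ψ t ^ 2 := by nlinarith [h.le_one t, h.nonneg t]
          positivity
        have h4 : Real.exp (-2 * ω * t) * ‖S t x‖ ^ 2 ≤ p t * ‖(x : H)‖ ^ 2 := by
          rw [hp t ht.le, mul_assoc (Real.exp _), ← mul_pow]
          gcongr
          exact (S t).le_of_opNorm_le (hm t ht.le) x
        have h5 := mul_le_mul_of_nonneg_left h4 (div_nonneg hkt hpt.le)
        have h6 : k t / p t * (p t * ‖(x : H)‖ ^ 2) = k t * ‖(x : H)‖ ^ 2 := by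
          field_simp
        rw [h6] at h5
        linear_combination h5
      · have hat : a < t := by
          by_contra! h'
          exact h1 ⟨ht, h'⟩
        rw [indicator_of_notMem h1, zero_add]
        by_cases h2 : t ∈ Ioc (T - a) T
        · rw [indicator_of_mem h2, h.sq_cutoff_sub_of_ge hT h2.1.le]
          have hs : 0 ≤ T - t := sub_nonneg.2 h2.2
          have hps := h.density_pos _ hs
          have h3 : 0 ≤ 1 - ψ (T - t) ^ 2 := by nlinarith [h.le_one (T - t), h.nonneg (T - t)]
          have h4 : E ≤ p (T - t) * (Real.exp (-2 * ω * t) * ‖S t x‖ ^ 2) := by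
            calc E ≤ Real.exp (-2 * ω * T) * (m (T - t) * ‖S t x‖) ^ 2 := by
                  rw [hE]
                  gcongr
                  exact (hS.norm_apply_le ht.le h2.2 x).trans (by gcongr; exact hm _ hs)
              _ = (Real.exp (-2 * ω * (T - t)) * Real.exp (-2 * ω * t)) *
                    (m (T - t) * ‖S t x‖) ^ 2 := by
                  rw [← Real.exp_add]
                  ring_nf
              _ = _ := by rw [hp _ hs]; ring
          calc c ^ 2 * E * k (T - t) ≤
              c ^ 2 * (p (T - t) * (Real.exp (-2 * ω * t) * ‖S t x‖ ^ 2)) * k (T - t) := by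
                gcongr
            _ = _ := by
                simp only [hk, ← hc]
                field_simp
        · rw [indicator_of_notMem h2]
          have := h.sq_cutoff_sub_nonneg (T := T) hat.le
          positivity)
  have hsub1 : Ioi (0 : ℝ) ∩ Ioc 0 a = Ioc 0 a := inter_eq_right.2 fun t ht => ht.1
  have hsub2 : Ioi (0 : ℝ) ∩ Ioc (T - a) T = Ioc (T - a) T := inter_eq_right.2 fun t ht =>
    (by linarith : 0 < T - a).trans ht.1
  rw [integral_add (by exact i1) (by exact i2), setIntegral_indicator measurableSet_Ioc,
    setIntegral_indicator measurableSet_Ioc, hsub1, hsub2, integral_const_mul, integral_const_mul,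
    ← intervalIntegral.integral_of_le ha.le, ← intervalIntegral.integral_of_le hTa,
    intervalIntegral.integral_comp_sub_left, sub_self, sub_sub_cancel] at key
  have h1 : c ^ 2 * E ≤ ‖(x : H)‖ ^ 2 := by
    refine le_of_mul_le_mul_right ?_ hK
    linear_combination key
  have h2 : c * Real.exp (-ω * T) * ‖S T x‖ ≤ ‖(x : H)‖ := by
    refine le_of_sq_le_sq (le_trans (le_of_eq ?_) h1) (norm_nonneg _)
    rw [mul_pow, mul_pow, ← Real.exp_nat_mul, hE]
    push_cast
    ring_nf
  have h3 : Real.exp (r * (T - 2 * a)) * Real.exp (-ω * T) * Real.exp ((ω - r) * (T - 2 * a)) =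
      Real.exp (-2 * ω * a) := by
    rw [← Real.exp_add, ← Real.exp_add]
    ring_nf
  have hma : p a = Real.exp (-2 * ω * a) * m a ^ 2 := hp a ha.le
  calc ‖S T x‖ = c * Real.exp (-ω * T) * ‖S T x‖ *
        (Real.exp ((ω - r) * (T - 2 * a)) * m a ^ 2) := by
        rw [hc, eq_comm, div_mul_eq_mul_div, div_mul_eq_mul_div, div_mul_eq_mul_div,
          div_eq_iff hpa.ne', hma, ← h3]
        ring
    _ ≤ ‖(x : H)‖ * (Real.exp ((ω - r) * (T - 2 * a)) * m a ^ 2) := by gcongr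
    _ = _ := mul_comm _ _

end Riccati

section Extension

variable {r a : ℝ} {μ φ : ℝ → ℝ}

theorem riccati_nonneg (hr : 0 < r) (h0 : φ 0 = 0)
    (hφ : ∀ t ∈ Icc 0 a,
      HasDerivWithinAt φ (r * (φ t ^ 2 + 2 * μ t * φ t + 1)) (Icc 0 a) t) :
    ∀ t ∈ Icc 0 a, 0 ≤ φ t := by
  intro t ht
  have := image_le_of_deriv_right_lt_deriv_boundary' (f := fun t => -φ t)
    (f' := fun t => -(r * (φ t ^ 2 + 2 * μ t * φ t + 1))) (a := 0) (b := a) (B := fun _ => 0)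
    (B' := fun _ => 0) (fun t ht => (hφ t ht).continuousWithinAt.neg)
    (fun t ht => ((hφ t (Ico_subset_Icc_self ht)).mono_of_mem_nhdsWithin
      (Icc_mem_nhdsGE_of_mem ht)).neg) (by simp [h0]) continuousOn_const
    (fun t _ => hasDerivWithinAt_const _ _ _)
    (fun t _ h => by
      have h1 : φ t = 0 := neg_eq_zero.1 h
      rw [h1]
      linarith) ht
  linarith

theorem exists_riccatiSystem (hr : 0 < r) (ha : 0 < a) (h0 : φ 0 = 0) (h1 : φ a = 1)
    (hlt : ∀ t ∈ Ico 0 a, φ t < 1)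
    (hφ : ∀ t ∈ Icc 0 a,
      HasDerivWithinAt φ (r * (φ t ^ 2 + 2 * μ t * φ t + 1)) (Icc 0 a) t) {p : ℝ → ℝ}
    (hp : ∀ s, 0 ≤ s → HasDerivWithinAt p (2 * r * μ s * p s) (Ici 0) s)
    (hp_pos : ∀ s, 0 ≤ s → 0 < p s) :
    ∃ ψ η, RiccatiSystem r a μ ψ η p := by
  set ψ : ℝ → ℝ := fun s => φ (max 0 (min s a)) with hψ
  have hmem : ∀ s, max 0 (min s a) ∈ Icc 0 a := fun s =>
    ⟨le_max_left _ _, max_le ha.le (min_le_right _ _)⟩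
  have hψφ : ∀ s ∈ Icc 0 a, ψ s = φ s := fun s hs => by
    simp only [hψ, min_eq_left hs.2, max_eq_right hs.1]
  have hcont : Continuous ψ := by
    have hc : ContinuousOn φ (Icc 0 a) := fun t ht => (hφ t ht).continuousWithinAt
    exact hc.comp_continuous (by fun_prop) hmem
  have hzero : ∀ s ≤ 0, ψ s = 0 := fun s hs => by
    simp only [hψ, max_eq_left (min_le_of_left_le hs), h0]
  have hint : ∀ s, HasDerivAt (fun s => ∫ u in (0 : ℝ)..s, ψ u) (ψ s) s := fun s =>
    intervalIntegral.integral_hasDerivAt_right (hcont.intervalIntegrable _ _)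
      hcont.stronglyMeasurable.stronglyMeasurableAtFilter hcont.continuousAt
  refine ⟨ψ, fun s => Real.exp (-r * ∫ u in (0 : ℝ)..s, ψ u), ⟨hr, ha, hcont, hzero, ?_,
    fun s => riccati_nonneg hr h0 hφ _ (hmem s), ?_, ?_, ?_, ?_, fun s => Real.exp_pos _, ?_, hp,
    hp_pos⟩⟩
  · rw [hψφ a ⟨ha.le, le_rfl⟩, h1]
  · intro s
    rcases (hmem s).2.eq_or_lt with h | h
    · simp only [hψ, h, h1, le_rfl]
    · exact (hlt _ ⟨(hmem s).1, h⟩).le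
  · intro s hs
    exact hlt _ ⟨(hmem s).1, max_lt ha (min_lt_of_left_lt hs)⟩
  · intro s hs
    have hs' := Ico_subset_Icc_self hs
    have hI := Icc_mem_nhdsGT_of_mem hs
    rw [hψφ s hs']
    refine ((hφ s hs').mono_of_mem_nhdsWithin hI).congr_of_eventuallyEq ?_ (hψφ s hs')
    filter_upwards [hI] with u hu using hψφ u hu
  · intro s
    refine ((hint s).const_mul (-r)).exp.congr_deriv ?_
    ring
  · intro s hs
    have : ∫ u in (0 : ℝ)..s, ψ u = 0 := by
      rw [intervalIntegral.integral_symm, intervalIntegral.integral_of_le hs,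
        setIntegral_congr_fun measurableSet_Ioc fun u hu => hzero u hu.2]
      simp
    simp only [this, mul_zero, Real.exp_zero]

end Extension

theorem statement3 {H : Type*} [NormedAddCommGroup H] [InnerProductSpace ℂ H] [CompleteSpace H]
    (S : ℝ → H →L[ℂ] H) (D : Submodule ℂ H) (A : D →ₗ[ℂ] H)
    (hS : IsC0Semigroup S) (hA : IsGenerator S D A)
    (ω r : ℝ) (hr : 0 < r) (hres : ResolventBound D A ω r)
    (m m' : ℝ → ℝ) (hm_pos : ∀ t, 0 ≤ t → 0 < m t)
    (hm_deriv : ∀ t ∈ Ici (0:ℝ), HasDerivWithinAt m (m' t) (Ici 0) t)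
    (hm'_cont : ContinuousOn m' (Ici 0))
    (hm_bound : ∀ t, 0 ≤ t → ‖S t‖ ≤ m t)
    (μ : ℝ → ℝ) (hμ : ∀ t, μ t = (1 / r) * (m' t / m t - ω))
    (astar : ℝ) (hastar : 0 < astar)
    (φ : ℝ → ℝ) (hφ0 : φ 0 = 0)
    (hφ : ∀ t ∈ Icc (0:ℝ) astar,
      HasDerivWithinAt φ (r * (φ t ^ 2 + 2 * μ t * φ t + 1)) (Icc 0 astar) t)
    (hφ1 : φ astar = 1) (hφlt : ∀ t ∈ Ico (0:ℝ) astar, φ t < 1) :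
    ∀ t, 2 * astar ≤ t →
      ‖S t‖ ≤ Real.exp ((ω - r) * (t - 2 * astar)) * m astar ^ 2 := by
  intro T hT
  have hm : ContinuousOn m (Ici 0) := fun t ht => (hm_deriv t ht).continuousWithinAt
  obtain ⟨C₀, ν₀, hC₀⟩ := hS.exists_growth hm hm_bound
  obtain ⟨C, ν, hν, hC⟩ := hS.exists_growth_lt hA hr hres hC₀
  have hp : ∀ s, 0 ≤ s → HasDerivWithinAt (fun t => Real.exp (-2 * ω * t) * m t ^ 2)
      (2 * r * μ s * (Real.exp (-2 * ω * s) * m s ^ 2)) (Ici 0) s := by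
    intro s hs
    have d := (((hasDerivAt_id s).const_mul (-2 * ω)).exp.hasDerivWithinAt (s := Ici 0)).mul
      ((hm_deriv s hs).pow 2)
    refine d.congr_deriv ?_
    have h0 := (hm_pos s hs).ne'
    rw [hμ]
    simp only [id, Pi.pow_apply]
    field_simp
    ring
  obtain ⟨ψ, η, h⟩ := exists_riccatiSystem hr hastar hφ0 hφ1 hφlt hφ hp fun s hs => by
    have := hm_pos s hs
    positivity
  exact opNorm_le_of_dense hA.dense (by positivity) fun x =>
    h.norm_apply_le hS hA hres hC hν hm_bound (fun _ _ => rfl) hT x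
end
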